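/- arXiv:1907.13068 — 10 statements merged into one kernel-verified Lean document; each statement's English description precedes it below -/
import Mathlib

section
/- Let q be a prime power, m ≥ 1, and let A ⊆ [0,q−1]^m be a nonempty finite set of exponent vectors. Then every nonzero codeword of the affine code C_A has Hamming weight at least min_{(i_1,…,i_m)∈A} (q−i_1)⋯(q−i_m); in particular the minimum distance satisfies d(C_A) ≥ FB(C_A). -/
/-- The affine code `C_A`: evaluations at all points of `F^m` of polynomials whose
monomial support lies in `A`. -/
noncomputable def affineCode (F : Type) [Field F] [Fintype F] (m : ℕ)
    (A : Set (Fin m → ℕ)) : Set ((Fin m → F) → F) :=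
  {v | ∃ f : MvPolynomial (Fin m) F,
        (∀ d ∈ f.support, (d : Fin m → ℕ) ∈ A) ∧ v = fun P => MvPolynomial.eval P f}

/-- A nonzero polynomial over an integral domain takes at least `#S - natDegree` nonzero values on a
finite set `S`. -/
lemma Polynomial.card_sub_natDegree_le_card_filter_eval_ne_zero {R : Type*} [CommRing R]
    [IsDomain R] [DecidableEq R] {p : Polynomial R} (hp : p ≠ 0) (S : Finset R) :
    S.card - p.natDegree ≤ (S.filter fun x => p.eval x ≠ 0).card := by
  have hroots : (S.filter fun x => p.eval x = 0).card ≤ p.natDegree :=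
    calc
      (S.filter fun x => p.eval x = 0).card ≤ p.roots.toFinset.card :=
        Finset.card_le_card fun x hx => by simp_all
      _ ≤ p.roots.card := p.roots.toFinset_card_le
      _ ≤ p.natDegree := p.card_roots'
  have hsplit := S.card_filter_add_card_filter_not fun x => p.eval x = 0
  simp only [ne_eq]
  omega

/-- The **footprint bound**: a nonzero multivariate polynomial over an integral domain has a
monomial `d` such that the polynomial takes at least `∏ i, (#(S i) - d i)` nonzero values on the
grid `∏ i, S i`. -/
lemma MvPolynomial.exists_mem_support_prod_card_sub_le {R : Type*} [CommRing R] [IsDomain R]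
    [DecidableEq R] {n : ℕ} {f : MvPolynomial (Fin n) R} (hf : f ≠ 0) (S : Fin n → Finset R) :
    ∃ d ∈ f.support, ∏ i, ((S i).card - d i) ≤
      ((Fintype.piFinset S).filter fun x => eval x f ≠ 0).card := by
  induction n with
  | zero =>
    obtain ⟨d, hd⟩ := support_nonempty.mpr hf
    refine ⟨d, hd, ?_⟩
    rw [f.eq_C_of_isEmpty] at hf ⊢
    simp [C_ne_zero.mp hf]
  | succ n ih =>
    set p := finSuccEquiv R n f with hp
    have hp0 : p ≠ 0 := EmbeddingLike.map_ne_zero_iff.2 hf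
    obtain ⟨d, hd, hle⟩ := ih (Polynomial.leadingCoeff_ne_zero.2 hp0) (Fin.tail S)
    refine ⟨d.cons p.natDegree, mem_support_coeff_finSuccEquiv.mp hd, ?_⟩
    set T := (Fintype.piFinset (Fin.tail S)).filter fun y => eval y p.leadingCoeff ≠ 0 with hT
    have hfiber : ∀ y ∈ T, (S 0).card - p.natDegree ≤
        ((S 0).filter fun x => (p.map (eval y)).eval x ≠ 0).card := fun y hy => by
      have hy : eval y p.leadingCoeff ≠ 0 := (Finset.mem_filter.1 hy).2
      rw [← Polynomial.natDegree_map_of_leadingCoeff_ne_zero _ hy]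
      refine Polynomial.card_sub_natDegree_le_card_filter_eval_ne_zero (fun h => hy ?_) _
      simpa using congr_arg (Polynomial.coeff · p.natDegree) h
    calc
      ∏ i, ((S i).card - d.cons p.natDegree i)
          = (∏ i, ((Fin.tail S i).card - d i)) * ((S 0).card - p.natDegree) := by
        simp [Fin.prod_univ_succ, Fin.tail, mul_comm]
      _ ≤ T.card * ((S 0).card - p.natDegree) := by gcongr
      _ ≤ ∑ y ∈ T, ((S 0).filter fun x => (p.map (eval y)).eval x ≠ 0).card := by
        simpa using Finset.card_nsmul_le_sum T _ _ hfiber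
      _ = (T.sigma fun y => (S 0).filter fun x => (p.map (eval y)).eval x ≠ 0).card :=
        (Finset.card_sigma _ _).symm
      _ ≤ ((Fintype.piFinset S).filter fun x => eval x f ≠ 0).card := by
        refine Finset.card_le_card_of_injOn (fun z => Fin.cons z.2 z.1) ?_ ?_
        · rintro ⟨y, x⟩ hz
          simp_all [Fin.forall_fin_succ, Fin.tail, eval_eq_eval_mv_eval']
        · rintro ⟨y, x⟩ - ⟨y', x'⟩ - h
          obtain ⟨rfl, rfl⟩ := Fin.cons_inj.1 h
          rfl

theorem stmt0 (F : Type) [Field F] [Fintype F] [DecidableEq F]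
    (m : ℕ) (hm : 1 ≤ m) (A : Finset (Fin m → ℕ)) (hA : A.Nonempty)
    (hbox : ∀ a ∈ A, ∀ i, a i ≤ Fintype.card F - 1)
    (v : (Fin m → F) → F) (hv : v ∈ affineCode F m ↑A) (hv0 : v ≠ 0) :
    A.inf' hA (fun a => ∏ i, (Fintype.card F - a i)) ≤ hammingNorm v := by
  obtain ⟨f, hfA, rfl⟩ := hv
  have hf : f ≠ 0 := by
    rintro rfl
    exact hv0 (by ext; simp)
  obtain ⟨d, hd, hle⟩ := f.exists_mem_support_prod_card_sub_le hf fun _ => Finset.univ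
  refine (A.inf'_le _ (hfA d hd)).trans ?_
  simpa [hammingNorm] using hle
end

section
/- Let q be a prime power, m ≥ 1, and f ∈ 𝔽_q[X_1,…,X_m]. Let I_{q,f} = ⟨X_1^q−X_1, …, X_m^q−X_m, f⟩ and R_f = 𝔽_q[X_1,…,X_m]/I_{q,f}. Then the dimension of R_f as an 𝔽_q-vector space equals the number of points P ∈ 𝔽_q^m with f(P) = 0. -/
/-- The ideal `I_{q,f} = ⟨X_1^q − X_1, …, X_m^q − X_m, f⟩`. -/
noncomputable def Iqf (F : Type) [Field F] [Fintype F] (m : ℕ)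
    (f : MvPolynomial (Fin m) F) : Ideal (MvPolynomial (Fin m) F) :=
  Ideal.span ({f} ∪ Set.range (fun i : Fin m =>
    (MvPolynomial.X i) ^ (Fintype.card F) - MvPolynomial.X i))

/-- Over a finite field, `X ^ q - X` is the product of all monic linear polynomials. -/
theorem prod_X_sub_C_eq_X_pow_card_sub_X (F : Type*) [Field F] [Fintype F] :
    ∏ s : F, (Polynomial.X - Polynomial.C s) =
      (Polynomial.X ^ Fintype.card F - Polynomial.X : Polynomial F) := by
  have hdeg := FiniteField.X_pow_card_sub_X_natDegree_eq F (Fintype.one_lt_card (α := F))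
  have h := Polynomial.prod_multiset_X_sub_C_of_monic_of_roots_card_eq
    (p := (Polynomial.X ^ Fintype.card F - Polynomial.X : Polynomial F))
    (Polynomial.monic_X_pow_sub (by simpa using Fintype.one_lt_card (α := F)))
    (by rw [hdeg, FiniteField.roots_X_pow_card_sub_X]; rfl)
  rwa [FiniteField.roots_X_pow_card_sub_X] at h

/-- A polynomial over a finite field vanishing at every point lies in the ideal of the
field equations. -/
theorem mem_span_X_pow_card_sub_X_of_eval_eq_zero {F σ : Type*} [Field F] [Fintype F] [Finite σ]
    (g : MvPolynomial σ F) (hg : ∀ P : σ → F, MvPolynomial.eval P g = 0) :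
    g ∈ Ideal.span (Set.range (fun i : σ =>
      (MvPolynomial.X i : MvPolynomial σ F) ^ Fintype.card F - MvPolynomial.X i)) := by
  obtain ⟨h, -, hh⟩ := MvPolynomial.combinatorial_nullstellensatz_exists_linearCombination
    (fun _ : σ => (Finset.univ : Finset F)) (fun _ => Finset.univ_nonempty) g (fun x _ => hg x)
  rw [hh, Finsupp.linearCombination_apply]
  refine Submodule.sum_mem _ fun i _ => ?_
  refine Ideal.mul_mem_left _ _ (Ideal.subset_span ⟨i, ?_⟩)
  simpa using (congrArg (Polynomial.aeval (MvPolynomial.X i : MvPolynomial σ F))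
    (prod_X_sub_C_eq_X_pow_card_sub_X F)).symm

theorem mem_Iqf_iff (F : Type) [Field F] [Fintype F] (m : ℕ) (f g : MvPolynomial (Fin m) F) :
    g ∈ Iqf F m f ↔ ∀ P, MvPolynomial.eval P f = 0 → MvPolynomial.eval P g = 0 := by
  constructor
  · intro hg P hP
    have hle : Iqf F m f ≤ RingHom.ker (MvPolynomial.eval P) := by
      refine Ideal.span_le.2 ?_
      rintro _ (rfl | ⟨i, rfl⟩)
      · exact hP
      · simp [RingHom.mem_ker, FiniteField.pow_card]
    exact hle hg
  · intro h
    have hq : Fintype.card F - 1 ≠ 0 := by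
      have := Fintype.one_lt_card (α := F)
      omega
    have hmem : g * (1 - f ^ (Fintype.card F - 1)) ∈ Iqf F m f := by
      refine Ideal.span_mono Set.subset_union_right
        (mem_span_X_pow_card_sub_X_of_eval_eq_zero _ fun P => ?_)
      by_cases hP : MvPolynomial.eval P f = 0
      · simp [h P hP]
      · simp [FiniteField.pow_card_sub_one_eq_one _ hP]
    have hf : f ∈ Iqf F m f := Ideal.subset_span (Or.inl rfl)
    have := add_mem hmem (Ideal.mul_mem_left _ g (Ideal.pow_mem_of_mem _ hf _ hq.bot_lt))
    rwa [← mul_add, sub_add_cancel, mul_one] at this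

/-- Evaluation of polynomials on a set of points, as an algebra homomorphism. -/
noncomputable def evalOnAlgHom {F σ : Type*} [Field F] (S : Set (σ → F)) :
    MvPolynomial σ F →ₐ[F] (S → F) :=
  AlgHom.pi fun P => MvPolynomial.aeval P.1

theorem evalOnAlgHom_apply {F σ : Type*} [Field F] (S : Set (σ → F)) (g : MvPolynomial σ F)
    (P : S) : evalOnAlgHom S g P = MvPolynomial.eval P.1 g := by
  simp [evalOnAlgHom, MvPolynomial.aeval_eq_eval]

theorem evalOnAlgHom_surjective {F σ : Type*} [Field F] [Finite F] [Finite σ]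
    (S : Set (σ → F)) : Function.Surjective (evalOnAlgHom S) := by
  classical
  have := Fintype.ofFinite F
  intro e
  obtain ⟨g, -, hg⟩ := (MvPolynomial.map_restrict_dom_evalₗ F σ).ge
    (Submodule.mem_top (x := fun P => if h : P ∈ S then e ⟨P, h⟩ else 0))
  refine ⟨g, funext fun P => ?_⟩
  rw [evalOnAlgHom_apply]
  simpa using congrFun hg P.1

theorem stmt1 (F : Type) [Field F] [Fintype F] (m : ℕ) (hm : 1 ≤ m)
    (f : MvPolynomial (Fin m) F) :
    Module.finrank F (MvPolynomial (Fin m) F ⧸ Iqf F m f) =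
      Set.ncard {P : Fin m → F | MvPolynomial.eval P f = 0} := by
  classical
  set S := {P : Fin m → F | MvPolynomial.eval P f = 0} with hS
  have hker : Iqf F m f = RingHom.ker (evalOnAlgHom S) := by
    ext g
    simp [mem_Iqf_iff, RingHom.mem_ker, funext_iff, evalOnAlgHom_apply, hS]
  rw [hker, (Ideal.quotientKerAlgEquivOfSurjective
    (evalOnAlgHom_surjective S)).toLinearEquiv.finrank_eq, Module.finrank_fintype_fun_eq_card,
    ← Nat.card_eq_fintype_card, Nat.card_coe_set_eq]
end

section
/- Let q be a prime power, m ≥ 1, and s ∈ ℕ with s ≤ (q−1)m. Write s = a(q−1) + b with a, b ∈ ℕ, 0 ≤ a ≤ m−1 and 0 ≤ b ≤ q−1. Then the minimum distance of the Reed-Muller code RM_q(s,m) equals (q−b)·q^{m−1−a}. -/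
/-- The minimum distance of a code: the minimum Hamming weight of a nonzero codeword. -/
noncomputable def minDist (F : Type) [Field F] [Fintype F] [DecidableEq F] {m : ℕ}
    (C : Set ((Fin m → F) → F)) : ℕ :=
  sInf {w | ∃ v ∈ C, v ≠ 0 ∧ hammingNorm v = w}

open MvPolynomial in
/-- The footprint bound: a nonzero polynomial over a finite field has at least `∏ (q - dᵢ)`
non-zeros, for some monomial `d` of its support. -/
theorem exists_mem_support_prod_le_card_eval_ne_zero (F : Type) [Field F] [Fintype F]
    [DecidableEq F] {n : ℕ} (f : MvPolynomial (Fin n) F) (hf : f ≠ 0) :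
    ∃ d ∈ f.support, ∏ i, (Fintype.card F - d i) ≤
      (Finset.univ.filter fun x : Fin n → F => eval x f ≠ 0).card := by
  induction n with
  | zero =>
    obtain ⟨d, hd⟩ := MvPolynomial.support_nonempty.mpr hf
    refine ⟨d, hd, ?_⟩
    obtain ⟨c, rfl⟩ := MvPolynomial.C_surjective (Fin 0) f
    have hc : c ≠ 0 := by rintro rfl; simp at hf
    simp [hc]
  | succ n ih =>
    set g := finSuccEquiv F n f with hg
    have hg0 : g ≠ 0 := by simpa [hg] using hf
    obtain ⟨d, hd, hle⟩ := ih g.leadingCoeff (Polynomial.leadingCoeff_ne_zero.mpr hg0)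
    refine ⟨d.cons g.natDegree, mem_support_coeff_finSuccEquiv.mp hd, ?_⟩
    rw [Fin.prod_univ_succ]
    simp only [Finsupp.cons_zero, Finsupp.cons_succ]
    have hfib : ∀ P : Fin n → F, eval P g.leadingCoeff ≠ 0 →
        Fintype.card F - g.natDegree ≤
          (Finset.univ.filter fun t : F => eval (Fin.cons t P : Fin (n + 1) → F) f ≠ 0).card := by
      intro P hP
      set p := g.map (eval P) with hp
      have hp0 : p ≠ 0 := fun h => hP (by
        simpa [hp, Polynomial.coeff_map] using congrArg (fun r => r.coeff g.natDegree) h)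
      have hzero : (Finset.univ.filter fun t : F =>
          ¬ eval (Fin.cons t P : Fin (n + 1) → F) f ≠ 0).card ≤ g.natDegree := by
        refine le_trans (Finset.card_le_card (t := p.roots.toFinset) fun t ht => ?_) <|
          (Multiset.toFinset_card_le _).trans <|
            (Polynomial.card_roots' p).trans Polynomial.natDegree_map_le
        simpa [hp0, eval_eq_eval_mv_eval'] using ht
      have := Finset.card_filter_add_card_filter_not (s := (Finset.univ : Finset F))
        (fun t : F => eval (Fin.cons t P : Fin (n + 1) → F) f ≠ 0)
      rw [Finset.card_univ] at this
      omega
    have hcard : (Finset.univ.filter fun x : Fin (n + 1) → F => eval x f ≠ 0).card =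
        ∑ P : Fin n → F,
          (Finset.univ.filter fun t : F =>
            eval (Fin.cons t P : Fin (n + 1) → F) f ≠ 0).card := by
      simp only [Finset.card_filter]
      rw [← (Fin.consEquiv fun _ : Fin (n + 1) => F).sum_comp, Fintype.sum_prod_type_right]
      rfl
    calc (Fintype.card F - g.natDegree) * ∏ i, (Fintype.card F - d i)
        ≤ (Fintype.card F - g.natDegree) *
          (Finset.univ.filter fun P : Fin n → F => eval P g.leadingCoeff ≠ 0).card :=
          Nat.mul_le_mul_left _ hle
      _ = ∑ P ∈ Finset.univ.filter fun P : Fin n → F => eval P g.leadingCoeff ≠ 0,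
            (Fintype.card F - g.natDegree) := by
          rw [Finset.sum_const, smul_eq_mul, mul_comm]
      _ ≤ ∑ P ∈ Finset.univ.filter fun P : Fin n → F => eval P g.leadingCoeff ≠ 0,
            (Finset.univ.filter fun t : F =>
              eval (Fin.cons t P : Fin (n + 1) → F) f ≠ 0).card :=
          Finset.sum_le_sum fun P hP => hfib P (Finset.mem_filter.mp hP).2
      _ ≤ _ := by
          rw [hcard]
          exact Finset.sum_le_sum_of_subset (Finset.filter_subset _ _)

/-- Among exponent vectors bounded by `q - 1` with sum at most `a * (q - 1) + b`, the product
`∏ (q - dᵢ)` is smallest when the exponents are concentrated greedily. -/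
theorem le_prod_sub_mul_pow {q : ℕ} (hq : 1 ≤ q) {n : ℕ} (d : Fin n → ℕ)
    (hd : ∀ i, d i ≤ q - 1) (a b : ℕ) (hb : b ≤ q - 1) (hsum : ∑ i, d i ≤ a * (q - 1) + b) :
    (q - b) * q ^ n ≤ (∏ i, (q - d i)) * q ^ (a + 1) := by
  obtain ⟨r, rfl⟩ : ∃ r, q = r + 1 := ⟨q - 1, by omega⟩
  simp only [Nat.add_sub_cancel] at *
  induction n generalizing a b with
  | zero =>
    simp only [pow_zero, mul_one, Finset.univ_eq_empty, Finset.prod_empty, one_mul]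
    exact (Nat.sub_le _ _).trans (Nat.le_self_pow (by omega) _)
  | succ n ih =>
    rw [Fin.prod_univ_succ]
    rw [Fin.sum_univ_succ] at hsum
    have hd0 := hd 0
    set R := ∏ i : Fin n, (r + 1 - d i.succ)
    rcases le_or_gt (d 0) b with h | h
    · have key := ih (fun i => d i.succ) a (b - d 0) (fun i => hd _) (by omega) (by omega)
      have hmul : (r + 1 - b) * (r + 1) ≤ (r + 1 - d 0) * (r + 1 - (b - d 0)) := by
        obtain ⟨c, rfl⟩ := Nat.exists_eq_add_of_le h
        obtain ⟨k, rfl⟩ := Nat.exists_eq_add_of_le hb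
        rw [show d 0 + c + k + 1 - (d 0 + c) = k + 1 by omega,
          show d 0 + c + k + 1 - d 0 = c + k + 1 by omega,
          show d 0 + c + k + 1 - (d 0 + c - d 0) = d 0 + k + 1 by omega]
        nlinarith [Nat.zero_le (c * d 0)]
      calc (r + 1 - b) * (r + 1) ^ (n + 1)
          = (r + 1 - b) * (r + 1) * (r + 1) ^ n := by ring
        _ ≤ (r + 1 - d 0) * (r + 1 - (b - d 0)) * (r + 1) ^ n := Nat.mul_le_mul_right _ hmul
        _ = (r + 1 - d 0) * ((r + 1 - (b - d 0)) * (r + 1) ^ n) := by ring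
        _ ≤ (r + 1 - d 0) * (R * (r + 1) ^ (a + 1)) := Nat.mul_le_mul_left _ key
        _ = _ := by ring
    · obtain _ | a := a
      · omega
      have key := ih (fun i => d i.succ) a (b + r - d 0) (fun i => hd _) (by omega)
        (by rw [add_mul] at hsum; omega)
      have hmul : r + 1 - b ≤ (r + 1 - d 0) * (r + 1 - (b + r - d 0)) := by
        obtain ⟨v, hv⟩ := Nat.exists_eq_add_of_lt h
        obtain ⟨k, rfl⟩ := Nat.exists_eq_add_of_le hd0
        rw [show d 0 + k + 1 - b = v + k + 2 by omega,
          show d 0 + k + 1 - d 0 = k + 1 by omega,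
          show d 0 + k + 1 - (b + (d 0 + k) - d 0) = v + 2 by omega]
        nlinarith [Nat.zero_le (k * v)]
      calc (r + 1 - b) * (r + 1) ^ (n + 1)
          ≤ (r + 1 - d 0) * (r + 1 - (b + r - d 0)) * (r + 1) ^ (n + 1) :=
            Nat.mul_le_mul_right _ hmul
        _ = (r + 1 - d 0) * ((r + 1 - (b + r - d 0)) * (r + 1) ^ n) * (r + 1) := by ring
        _ ≤ (r + 1 - d 0) * (R * (r + 1) ^ (a + 1)) * (r + 1) :=
            Nat.mul_le_mul_right _ (Nat.mul_le_mul_left _ key)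
        _ = _ := by ring

open MvPolynomial in
/-- For exponents `dᵢ ≤ q`, some polynomial with `dᵢ` as degree bounds has exactly
`∏ (q - dᵢ)` non-zeros. -/
theorem exists_hammingNorm_eval_eq_prod (F : Type) [Field F] [Fintype F] [DecidableEq F] {n : ℕ}
    (d : Fin n → ℕ) (hd : ∀ i, d i ≤ Fintype.card F) :
    ∃ f : MvPolynomial (Fin n) F, (∀ e ∈ f.support, ∀ i, e i ≤ d i) ∧
      hammingNorm (fun P => eval P f) = ∏ i, (Fintype.card F - d i) := by
  have hT : ∀ i, ∃ T : Finset F, T.card = d i := fun i => by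
    obtain ⟨T, -, hT⟩ := Finset.exists_subset_card_eq (s := (Finset.univ : Finset F)) (hd i)
    exact ⟨T, hT⟩
  choose T hT using hT
  refine ⟨∏ i, ∏ t ∈ T i, (X i - C t), fun e he i => ?_, ?_⟩
  · refine (degreeOf_le_iff.mp ?_) e he
    refine (degreeOf_prod_le _ _ _).trans ?_
    rw [Finset.sum_eq_single i]
    · refine (degreeOf_prod_le _ _ _).trans ?_
      rw [← hT i, Finset.card_eq_sum_ones]
      exact Finset.sum_le_sum fun t _ => (degreeOf_sub_le _ _ _).trans (by simp)
    · intro j _ hj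
      refine Nat.le_zero.mp ((degreeOf_prod_le _ _ _).trans ?_)
      exact (Finset.sum_nonpos fun t _ =>
        (degreeOf_sub_le _ _ _).trans (by simp [degreeOf_X, hj.symm]))
    · simp
  · have : (Finset.univ.filter fun P : Fin n → F =>
        eval P (∏ i, ∏ t ∈ T i, (X i - C t)) ≠ 0) = Fintype.piFinset fun i => (T i)ᶜ := by
      ext P
      simp only [map_prod, map_sub, eval_X, eval_C, Finset.mem_filter, Finset.mem_univ, true_and,
        Finset.prod_ne_zero_iff, sub_ne_zero, Fintype.mem_piFinset, Finset.mem_compl,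
        forall_true_left]
      exact forall_congr' fun i => ⟨fun h hP => h _ hP rfl, fun h t ht hPt => h (hPt ▸ ht)⟩
    rw [hammingNorm, this, Fintype.card_piFinset]
    simp [Finset.card_compl, hT]

theorem stmt2 (F : Type) [Field F] [Fintype F] [DecidableEq F]
    (m s a b : ℕ) (hm : 1 ≤ m)
    (hs : s ≤ (Fintype.card F - 1) * m)
    (hab : s = a * (Fintype.card F - 1) + b)
    (ha : a ≤ m - 1) (hb : b ≤ Fintype.card F - 1) :
    minDist F (affineCode F m
        {v : Fin m → ℕ | (∀ i, v i ≤ Fintype.card F - 1) ∧ ∑ i, v i ≤ s}) =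
      (Fintype.card F - b) * (Fintype.card F) ^ (m - 1 - a) := by
  have hq : 1 ≤ Fintype.card F := Fintype.card_pos
  set q := Fintype.card F with hqdef
  have hle : ∀ w ∈ {w | ∃ v ∈ affineCode F m
      {v : Fin m → ℕ | (∀ i, v i ≤ q - 1) ∧ ∑ i, v i ≤ s}, v ≠ 0 ∧ hammingNorm v = w},
      (q - b) * q ^ (m - 1 - a) ≤ w := by
    rintro _ ⟨_, ⟨f, hf, rfl⟩, hv, rfl⟩
    have hf0 : f ≠ 0 := by
      rintro rfl
      exact hv (by ext; simp)
    obtain ⟨d, hd, hdle⟩ := exists_mem_support_prod_le_card_eval_ne_zero F f hf0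
    obtain ⟨hd1, hd2⟩ := hf d hd
    have h := le_prod_sub_mul_pow hq (fun i => d i) hd1 a b hb (hab ▸ hd2)
    refine le_trans ?_ hdle
    refine Nat.le_of_mul_le_mul_right (c := q ^ (a + 1)) ?_ (by positivity)
    rwa [mul_assoc, ← pow_add, show m - 1 - a + (a + 1) = m by omega]
  have hmem : (q - b) * q ^ (m - 1 - a) ∈ {w | ∃ v ∈ affineCode F m
      {v : Fin m → ℕ | (∀ i, v i ≤ q - 1) ∧ ∑ i, v i ≤ s}, v ≠ 0 ∧ hammingNorm v = w} := by
    obtain ⟨k, rfl⟩ : ∃ k, m = a + 1 + k := ⟨m - 1 - a, by omega⟩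
    let c : ℕ → ℕ := fun i => if i < a then q - 1 else if i = a then b else 0
    have hc : ∀ i, c i ≤ q - 1 := fun i => by
      dsimp only [c]
      split_ifs <;> omega
    have hlt : ∀ i ∈ Finset.range a, c i = q - 1 := fun i hi => if_pos (Finset.mem_range.mp hi)
    have hca : c a = b := by simp [c]
    have hgt : ∀ i, c (a + 1 + i) = 0 := fun i => by
      dsimp only [c]
      rw [if_neg (by omega), if_neg (by omega)]
    have hsum : ∑ i : Fin (a + 1 + k), c i = s := by
      rw [Fin.sum_univ_eq_sum_range, Finset.sum_range_add, Finset.sum_range_succ,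
        Finset.sum_congr rfl hlt, hca]
      simp [hgt, hab]
    have hprod : ∏ i : Fin (a + 1 + k), (q - c i) = (q - b) * q ^ (a + 1 + k - 1 - a) := by
      rw [Fin.prod_univ_eq_prod_range (fun i => q - c i), Finset.prod_range_add,
        Finset.prod_range_succ, Finset.prod_congr rfl fun i hi => by rw [hlt i hi], hca]
      simp [hgt, Nat.sub_sub_self hq]
    obtain ⟨f, hf, hw⟩ := exists_hammingNorm_eval_eq_prod F (fun i : Fin (a + 1 + k) => c i)
      fun i => (hc i).trans (Nat.sub_le _ _)
    rw [hprod] at hw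
    refine ⟨_, ⟨f, fun e he => ⟨fun i => (hf e he i).trans (hc i), ?_⟩, rfl⟩, ?_, hw⟩
    · exact hsum ▸ Finset.sum_le_sum fun i _ => hf e he i
    · have hb' : 0 < q - b := by omega
      rw [← hammingNorm_ne_zero_iff, hw]
      positivity
  exact le_antisymm (Nat.sInf_le hmem) (le_csInf ⟨_, hmem⟩ hle)
end

section
/- Let q be a prime power, t ∈ ℕ with t ≤ 2(q−1), and d ∈ ℕ with 1 ≤ d ≤ q². Let D = RM_q(t,2) and E = Hyp_q(d,2). If d(D) = d(E), then k(D) ≤ k(E); moreover, k(D) < k(E) if and only if (t+5)/2 ≤ q ≤ (t+1)²/4. -/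
open MvPolynomial in
/-- The footprint bound: the evaluation vector of a nonzero polynomial has weight at least
`∏ i, (q - d i)` for some exponent `d` in its support. -/
theorem exists_mem_support_prod_le_hammingNorm {F : Type} [Field F] [Fintype F] [DecidableEq F] :
    ∀ {m : ℕ} (f : MvPolynomial (Fin m) F), f ≠ 0 →
      ∃ d ∈ f.support, ∏ i, (Fintype.card F - d i) ≤ hammingNorm fun P => eval P f := by
  intro m
  induction m with
  | zero =>
    intro f hf
    obtain ⟨d, hd⟩ := support_nonempty.mpr hf
    refine ⟨d, hd, ?_⟩
    rw [Finset.univ_eq_empty, Finset.prod_empty, Nat.one_le_iff_ne_zero, Ne, hammingNorm_eq_zero]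
    intro h
    apply hf
    rw [eq_C_of_isEmpty f] at h ⊢
    have := congrFun h 0
    simp only [eval_C, Pi.zero_apply] at this
    rw [this, C_0]
  | succ m ih =>
    intro f hf
    set p := finSuccEquiv F m f with hp
    have hp0 : p ≠ 0 := by simpa [hp] using hf
    obtain ⟨d, hd, hle⟩ := ih p.leadingCoeff (Polynomial.leadingCoeff_ne_zero.mpr hp0)
    refine ⟨d.cons p.natDegree, mem_support_coeff_finSuccEquiv.mp hd, ?_⟩
    rw [Fin.prod_univ_succ]
    simp only [Finsupp.cons_zero, Finsupp.cons_succ]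
    have hfiber : ∀ s : Fin m → F, eval s p.leadingCoeff ≠ 0 →
        Fintype.card F - p.natDegree ≤
          (Finset.univ.filter fun y : F => eval (Fin.cons y s) f ≠ 0).card := by
      intro s hs
      set r := Polynomial.map (eval s) p with hr
      have hr0 : r ≠ 0 := by
        intro h
        apply hs
        have := congrArg (fun u => Polynomial.coeff u p.natDegree) h
        simpa [hr, Polynomial.coeff_map] using this
      have hev : ∀ y, eval (Fin.cons y s : Fin (m + 1) → F) f = r.eval y := fun y =>
        eval_eq_eval_mv_eval' s y f
      simp only [hev]
      have h1 := Finset.card_filter_add_card_filter_not (s := (Finset.univ : Finset F))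
        (fun y => r.eval y = 0)
      have h2 : (Finset.univ.filter fun y : F => r.eval y = 0).card ≤ p.natDegree := by
        refine le_trans (Finset.card_le_card (t := r.roots.toFinset) ?_) ?_
        · intro y hy
          simpa [hr0] using hy
        · exact (Multiset.toFinset_card_le _).trans
            ((Polynomial.card_roots' r).trans Polynomial.natDegree_map_le)
      rw [Finset.card_univ] at h1
      simp only [ne_eq]
      omega
    have hsum : (hammingNorm fun P => eval P f) =
        ∑ s : Fin m → F, (Finset.univ.filter fun y : F => eval (Fin.cons y s) f ≠ 0).card := by
      simp only [hammingNorm, Finset.card_filter]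
      rw [Finset.sum_comm, ← Fintype.sum_prod_type']
      exact (Equiv.sum_comp (Fin.consEquiv fun _ => F)
        fun P => if eval P f ≠ 0 then 1 else 0).symm
    rw [hsum]
    calc (Fintype.card F - p.natDegree) * ∏ i, (Fintype.card F - d i)
        ≤ (Fintype.card F - p.natDegree) * hammingNorm fun P => eval P p.leadingCoeff := by gcongr
      _ = ∑ s ∈ Finset.univ.filter fun s : Fin m → F => eval s p.leadingCoeff ≠ 0,
            (Fintype.card F - p.natDegree) := by
          rw [Finset.sum_const, smul_eq_mul, mul_comm]; rfl
      _ ≤ ∑ s ∈ Finset.univ.filter fun s : Fin m → F => eval s p.leadingCoeff ≠ 0,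
            (Finset.univ.filter fun y : F => eval (Fin.cons y s) f ≠ 0).card :=
          Finset.sum_le_sum fun s hs => hfiber s (Finset.mem_filter.mp hs).2
      _ ≤ _ := Finset.sum_le_sum_of_subset (Finset.filter_subset _ _)

open MvPolynomial in
/-- For every `d` in the box `[0, q]^m` some polynomial whose exponents are dominated by `d`
has an evaluation vector of weight exactly `∏ i, (q - d i)`. -/
theorem exists_hammingNorm_eq_prod {F : Type} [Field F] [Fintype F] [DecidableEq F] {m : ℕ}
    (d : Fin m → ℕ) (hd : ∀ i, d i ≤ Fintype.card F) :
    ∃ f : MvPolynomial (Fin m) F, (∀ e ∈ f.support, (e : Fin m → ℕ) ≤ d) ∧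
      (hammingNorm fun P => eval P f) = ∏ i, (Fintype.card F - d i) := by
  choose S hS using fun i => Finset.exists_subset_card_eq
    (s := (Finset.univ : Finset F)) (n := d i) (by simpa using hd i)
  refine ⟨∏ i, ∏ a ∈ S i, (X i - C a), ?_, ?_⟩
  · intro e he i
    refine (monomial_le_degreeOf i he).trans ((degreeOf_prod_le _ _ _).trans ?_)
    calc _ ≤ ∑ j, if j = i then d i else 0 := by
          refine Finset.sum_le_sum fun j _ => (degreeOf_prod_le _ _ _).trans ?_
          have key : ∀ a : F, degreeOf i (X j - C a) ≤ if j = i then 1 else 0 := by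
            intro a
            refine (degreeOf_sub_le _ _ _).trans ?_
            rw [degreeOf_C, Nat.max_zero, degreeOf_X]
            simp only [eq_comm, le_refl]
          refine (Finset.sum_le_sum fun a _ => key a).trans ?_
          rw [Finset.sum_const, (hS j).2]
          split_ifs with h
          · simp [h]
          · simp
      _ = d i := by simp
  · have : (Finset.univ.filter fun P : Fin m → F =>
        eval P (∏ i, ∏ a ∈ S i, (X i - C a)) ≠ 0) = Fintype.piFinset fun i => (S i)ᶜ := by
      ext P
      simp only [map_prod, map_sub, eval_X, eval_C, Finset.mem_filter, Finset.mem_univ, true_and,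
        Fintype.mem_piFinset, Finset.mem_compl, Finset.prod_ne_zero_iff, sub_ne_zero, forall_const]
      exact ⟨fun h i hi => h i (P i) hi rfl, fun h i a ha e => h i (e ▸ ha)⟩
    rw [hammingNorm, this, Fintype.card_piFinset]
    exact Finset.prod_congr rfl fun i _ => by rw [Finset.card_compl, (hS i).2]

theorem minDist_affineCode_le {F : Type} [Field F] [Fintype F] [DecidableEq F] {m : ℕ}
    {A : Set (Fin m → ℕ)} (hA : IsLowerSet A) {d : Fin m → ℕ} (hd : d ∈ A)
    (hlt : ∀ i, d i < Fintype.card F) :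
    minDist F (affineCode F m A) ≤ ∏ i, (Fintype.card F - d i) := by
  obtain ⟨f, hf, hw⟩ := exists_hammingNorm_eq_prod (F := F) d fun i => (hlt i).le
  refine Nat.sInf_le ⟨_, ⟨f, fun e he => hA (hf e he) hd, rfl⟩, ?_, hw⟩
  rw [← hammingNorm_ne_zero_iff, hw]
  exact Finset.prod_ne_zero_iff.mpr fun i _ => by have := hlt i; omega

theorem exists_mem_prod_le_minDist_affineCode {F : Type} [Field F] [Fintype F] [DecidableEq F]
    {m : ℕ} {A : Set (Fin m → ℕ)} (hA : IsLowerSet A) (hne : A.Nonempty)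
    (hlt : ∀ d ∈ A, ∀ i, d i < Fintype.card F) :
    ∃ d ∈ A, ∏ i, (Fintype.card F - d i) ≤ minDist F (affineCode F m A) := by
  have hw : {w | ∃ v ∈ affineCode F m A, v ≠ 0 ∧ hammingNorm v = w}.Nonempty := by
    obtain ⟨d, hd⟩ := hne
    obtain ⟨f, hf, hw⟩ := exists_hammingNorm_eq_prod (F := F) d fun i => (hlt d hd i).le
    refine ⟨_, _, ⟨f, fun e he => hA (hf e he) hd, rfl⟩, ?_, hw⟩
    rw [← hammingNorm_ne_zero_iff, hw]
    exact Finset.prod_ne_zero_iff.mpr fun i _ => by have := hlt d hd i; omega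
  obtain ⟨v, ⟨f, hf, rfl⟩, hv, hmin⟩ := Nat.sInf_mem hw
  obtain ⟨d, hd, hle⟩ := exists_mem_support_prod_le_hammingNorm f (by
    rintro rfl
    exact hv (by ext; simp))
  exact ⟨d, hf d hd, hle.trans_eq hmin⟩

/-- A point of the box violating `a + b ≤ t` still has footprint at least `μ`, the minimal
footprint on `a + b ≤ t`, exactly when `(t + 5) / 2 ≤ q ≤ (t + 1) ^ 2 / 4`. -/
theorem exists_lt_add_and_le_mul_iff {q t μ : ℕ} (hq : 2 ≤ q) (ht : t ≤ 2 * (q - 1))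
    (hle : ∀ a b, a < q → b < q → a + b ≤ t → μ ≤ (q - a) * (q - b))
    (hex : ∃ a b, a < q ∧ b < q ∧ a + b ≤ t ∧ (q - a) * (q - b) ≤ μ) :
    (∃ a b, a < q ∧ b < q ∧ t < a + b ∧ μ ≤ (q - a) * (q - b)) ↔
      t + 5 ≤ 2 * q ∧ 4 * q ≤ (t + 1) ^ 2 := by
  obtain ⟨a₀, b₀, ha₀, hb₀, hab₀, hμ⟩ := hex
  rcases lt_or_ge t q with htq | htq
  · have hμ' : μ = (q - t) * q := by
      refine le_antisymm (by simpa using hle t 0 htq (by omega) (by omega)) (le_trans ?_ hμ)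
      zify [htq.le, ha₀.le, hb₀.le]
      nlinarith [mul_nonneg (Int.natCast_nonneg q) (sub_nonneg.mpr (Nat.cast_le (α := ℤ).mpr hab₀)),
        mul_nonneg (Int.natCast_nonneg a₀) (Int.natCast_nonneg b₀)]
    subst hμ'
    constructor
    · rintro ⟨a, b, ha, hb, hab, h⟩
      have hbt : b ≤ t := by
        by_contra! hbt
        have : (q - a) * (q - b) < (q - t) * q := by
          calc (q - a) * (q - b) ≤ q * (q - b) := by gcongr; omega
            _ < q * (q - t) := by
              apply Nat.mul_lt_mul_of_pos_left <;> omega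
            _ = _ := mul_comm _ _
        omega
      obtain ⟨c, hc⟩ := Nat.exists_eq_add_of_le (show b ≤ t + 1 by omega)
      have h' : (q - t) * q ≤ (q - c) * (q - b) := h.trans (by gcongr; omega)
      have hqcb : q ≤ c * b := by
        have hcq : c ≤ q := by omega
        zify [htq.le, hcq, hb.le] at h' hc ⊢
        have : (t : ℤ) = b + c - 1 := by linarith
        rw [this] at h'
        nlinarith
      have h4 : 4 * q ≤ (t + 1) ^ 2 := by
        rw [hc]
        zify at hqcb ⊢
        nlinarith [sq_nonneg ((b : ℤ) - c)]
      refine ⟨?_, h4⟩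
      have : 4 ≤ q := by nlinarith
      omega
    · rintro ⟨h1, h2⟩
      obtain ⟨a, b, hab, hba, hba'⟩ : ∃ a b, t + 1 = a + b ∧ a ≤ b ∧ b ≤ a + 1 :=
        ⟨(t + 1) / 2, t + 1 - (t + 1) / 2, by omega, by omega, by omega⟩
      refine ⟨a, b, by omega, by omega, by omega, ?_⟩
      have haq : a ≤ q := by omega
      have hbq : b ≤ q := by omega
      have hqab : q ≤ a * b := by
        rw [hab] at h2
        rcases (show b = a ∨ b = a + 1 by omega) with rfl | rfl
        · nlinarith
        · by_contra! hlt
          nlinarith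
      zify [htq.le, haq, hbq] at hab hqab ⊢
      have : (t : ℤ) = a + b - 1 := by linarith
      rw [this]
      nlinarith
  · have hμ' : μ = 2 * q - 1 - t := by
      apply le_antisymm
      · have := hle (q - 1) (t + 1 - q) (by omega) (by omega) (by omega)
        rw [show q - (q - 1) = 1 by omega, one_mul] at this
        omega
      · obtain ⟨x, hx⟩ := Nat.exists_eq_add_of_lt ha₀
        obtain ⟨y, hy⟩ := Nat.exists_eq_add_of_lt hb₀
        rw [show q - a₀ = x + 1 by omega, show q - b₀ = y + 1 by omega] at hμ
        have : x + y + 1 ≤ (x + 1) * (y + 1) := by nlinarith [Nat.zero_le (x * y)]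
        omega
    subst hμ'
    constructor
    · rintro ⟨a, b, ha, hb, hab, h⟩
      refine ⟨?_, ?_⟩
      swap
      · have := Nat.pow_le_pow_left (show q + 1 ≤ t + 1 by omega) 2
        zify at this ⊢
        nlinarith [sq_nonneg ((q : ℤ) - 1)]
      obtain ⟨x, hx⟩ := Nat.exists_eq_add_of_lt ha
      obtain ⟨y, hy⟩ := Nat.exists_eq_add_of_lt hb
      rw [show q - a = x + 1 by omega, show q - b = y + 1 by omega] at h
      have hxy : x + y + 2 ≤ (x + 1) * (y + 1) := by omega
      have hxy' : 0 < x * y := by nlinarith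
      have := Nat.pos_of_mul_pos_right hxy'
      have := Nat.pos_of_mul_pos_left hxy'
      omega
    · rintro ⟨h1, -⟩
      refine ⟨q - 2, t + 3 - q, by omega, by omega, by omega, ?_⟩
      rw [show q - (q - 2) = 2 by omega]
      omega

theorem stmt3 (F : Type) [Field F] [Fintype F] [DecidableEq F]
    (t d : ℕ) (ht : t ≤ 2 * (Fintype.card F - 1))
    (hd1 : 1 ≤ d) (hd2 : d ≤ (Fintype.card F) ^ 2)
    -- `D = RM_q(t,2)` is `C_A` and `E = Hyp_q(d,2)` is `C_B` with:
    (A B : Set (Fin 2 → ℕ))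
    (hA : A = {v : Fin 2 → ℕ | (∀ i, v i ≤ Fintype.card F - 1) ∧ v 0 + v 1 ≤ t})
    (hB : B = {v : Fin 2 → ℕ | (∀ i, v i ≤ Fintype.card F - 1) ∧
        d ≤ (Fintype.card F - v 0) * (Fintype.card F - v 1)})
    (hdist : minDist F (affineCode F 2 A) = minDist F (affineCode F 2 B)) :
    A.ncard ≤ B.ncard ∧
      (A.ncard < B.ncard ↔
        ((t : ℝ) + 5) / 2 ≤ (Fintype.card F : ℝ) ∧
        (Fintype.card F : ℝ) ≤ ((t : ℝ) + 1) ^ 2 / 4) := by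
  have hq : 2 ≤ Fintype.card F := Fintype.one_lt_card
  have lowA : IsLowerSet A := by
    subst hA
    intro u v hvu hu
    exact ⟨fun i => (hvu i).trans (hu.1 i), (add_le_add (hvu 0) (hvu 1)).trans hu.2⟩
  have lowB : IsLowerSet B := by
    subst hB
    intro u v hvu hu
    exact ⟨fun i => (hvu i).trans (hu.1 i), hu.2.trans
      (Nat.mul_le_mul (Nat.sub_le_sub_left (hvu 0) _) (Nat.sub_le_sub_left (hvu 1) _))⟩
  have ltA : ∀ v ∈ A, ∀ i, v i < Fintype.card F := by
    subst hA
    intro v hv i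
    have := hv.1 i
    omega
  have ltB : ∀ v ∈ B, ∀ i, v i < Fintype.card F := by
    subst hB
    intro v hv i
    have := hv.1 i
    omega
  have leA := fun v (hv : v ∈ A) => minDist_affineCode_le (F := F) lowA hv (ltA v hv)
  have leB := fun v (hv : v ∈ B) => minDist_affineCode_le (F := F) lowB hv (ltB v hv)
  obtain ⟨u, hu, hu'⟩ := exists_mem_prod_le_minDist_affineCode (F := F) lowA
    ⟨0, by subst hA; simp⟩ ltA
  obtain ⟨w, hw, hw'⟩ := exists_mem_prod_le_minDist_affineCode (F := F) lowB
    ⟨0, by subst hB; simpa [← pow_two] using hd2⟩ ltB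
  rw [← hdist] at leB hw'
  set μ := minDist F (affineCode F 2 A)
  simp only [Fin.prod_univ_two] at leA leB hu' hw'
  have memA : ∀ v : Fin 2 → ℕ, v ∈ A ↔
      v 0 < Fintype.card F ∧ v 1 < Fintype.card F ∧ v 0 + v 1 ≤ t := by
    intro v
    rw [hA, Set.mem_ofPred_eq, Fin.forall_fin_two]
    omega
  have memB : ∀ v : Fin 2 → ℕ, v ∈ B ↔ v 0 < Fintype.card F ∧ v 1 < Fintype.card F ∧
      μ ≤ (Fintype.card F - v 0) * (Fintype.card F - v 1) := by
    intro v
    refine ⟨fun hv => ⟨ltB v hv 0, ltB v hv 1, leB v hv⟩, fun ⟨h0, h1, h⟩ => ?_⟩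
    rw [hB] at hw ⊢
    exact ⟨Fin.forall_fin_two.mpr ⟨by omega, by omega⟩, hw.2.trans (hw'.trans h)⟩
  have hAB : A ⊆ B := fun v hv => (memB v).mpr ⟨ltA v hv 0, ltA v hv 1, leA v hv⟩
  have hfin : B.Finite := (Set.finite_Iic fun _ : Fin 2 => Fintype.card F).subset
    fun v hv i => (ltB v hv i).le
  have key := exists_lt_add_and_le_mul_iff hq ht
    (fun a b ha hb hab => leA ![a, b] ((memA _).mpr ⟨ha, hb, hab⟩))
    ⟨u 0, u 1, ltA u hu 0, ltA u hu 1, ((memA u).mp hu).2.2, hu'⟩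
  refine ⟨Set.ncard_le_ncard hAB hfin, ?_⟩
  have hlt : A.ncard < B.ncard ↔ ¬ B ⊆ A :=
    ⟨fun h hBA => h.not_ge (Set.ncard_le_ncard hBA (hfin.subset hAB)),
      fun h => Set.ncard_lt_ncard ⟨hAB, h⟩ hfin⟩
  have hreal : (((t : ℝ) + 5) / 2 ≤ (Fintype.card F : ℝ) ∧
      (Fintype.card F : ℝ) ≤ ((t : ℝ) + 1) ^ 2 / 4) ↔
      t + 5 ≤ 2 * Fintype.card F ∧ 4 * Fintype.card F ≤ (t + 1) ^ 2 := by
    rw [div_le_iff₀' two_pos, le_div_iff₀' four_pos]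
    norm_cast
  rw [hlt, hreal, ← key, Set.not_subset]
  constructor
  · rintro ⟨v, hvB, hvA⟩
    obtain ⟨h0, h1, h⟩ := (memB v).mp hvB
    refine ⟨v 0, v 1, h0, h1, ?_, h⟩
    by_contra! hle
    exact hvA ((memA v).mpr ⟨h0, h1, hle⟩)
  · rintro ⟨a, b, ha, hb, hab, h⟩
    exact ⟨![a, b], (memB _).mpr ⟨ha, hb, h⟩, fun hv => hab.not_ge ((memA _).mp hv).2.2⟩
end

section
/- Let q be a prime power, m ≥ 1, d ∈ ℕ, and let B ⊆ [0,q−1]^m be such that every nonzero codeword of the affine code C_B has Hamming weight at least d. Let C ⊆ ℝ^m be a convex set satisfying C ∩ {c ∈ ℝ^m : 2c ∈ [0,2q−2]^m ∩ ℤ^m and [2c]_q ∉ B} = ∅. Set A = C ∩ ([0,q−1]^m ∩ ℤ^m). Then every nonzero codeword of the square code C_A^{(2)} has Hamming weight at least d. -/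
/-- The square code `C^{(2)}`: the span of all componentwise (Schur) products of
pairs of codewords of `C`. -/
noncomputable def squareCode (F : Type) [Field F] {n : Type} (C : Set (n → F)) :
    Set (n → F) :=
  (Submodule.span F {v | ∃ c₁ ∈ C, ∃ c₂ ∈ C, v = c₁ * c₂} : Submodule F (n → F))

/-- Reduction `[b]_q` of an integer `b ∈ [0, 2q−2]`: `b` itself if `b ≤ q−1`, and
`b − (q−1)` otherwise. -/
def redq (q b : ℕ) : ℕ := if b ≤ q - 1 then b else b - (q - 1)

/-- The evaluation vector of the monomial with exponent vector `e`. -/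
def monomialVec (F : Type) [Field F] {m : ℕ} (e : Fin m → ℕ) : (Fin m → F) → F :=
  fun P => ∏ i, P i ^ e i

theorem monomialVec_mul (F : Type) [Field F] {m : ℕ} (a b : Fin m → ℕ) :
    monomialVec F a * monomialVec F b = monomialVec F (a + b) := by
  funext P
  simp [monomialVec, pow_add, Finset.prod_mul_distrib]

theorem affineCode_subset_span (F : Type) [Field F] [Fintype F] (m : ℕ)
    (A : Set (Fin m → ℕ)) :
    affineCode F m A ⊆ Submodule.span F (monomialVec F '' A) := by
  rintro v ⟨f, hf, rfl⟩
  have h : (fun P => MvPolynomial.eval P f) =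
      ∑ e ∈ f.support, f.coeff e • monomialVec F (e : Fin m → ℕ) := by
    funext P
    simp [MvPolynomial.eval_eq', monomialVec]
  rw [h]
  exact Submodule.sum_mem _ fun e he =>
    Submodule.smul_mem _ _ (Submodule.subset_span ⟨_, hf e he, rfl⟩)

theorem span_subset_affineCode (F : Type) [Field F] [Fintype F] (m : ℕ)
    (A : Set (Fin m → ℕ)) :
    (Submodule.span F (monomialVec F '' A) : Set ((Fin m → F) → F)) ⊆ affineCode F m A := by
  classical
  intro v hv
  induction hv using Submodule.span_induction with
  | mem x hx =>
    obtain ⟨a, ha, rfl⟩ := hx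
    refine ⟨MvPolynomial.monomial (Finsupp.equivFunOnFinite.symm a) 1, ?_, ?_⟩
    · intro e he
      obtain rfl := Finset.mem_singleton.mp (MvPolynomial.support_monomial_subset he)
      simpa using ha
    · funext P
      simp [monomialVec, MvPolynomial.eval_monomial, Finsupp.prod_fintype]
  | zero => exact ⟨0, by simp, by funext P; simp⟩
  | add x y _ _ hx hy =>
    obtain ⟨f, hf, rfl⟩ := hx
    obtain ⟨g, hg, rfl⟩ := hy
    refine ⟨f + g, fun e he => ?_, by funext P; simp⟩
    exact (Finset.mem_union.mp (MvPolynomial.support_add he)).elim (hf e) (hg e)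
  | smul c x _ hx =>
    obtain ⟨f, hf, rfl⟩ := hx
    exact ⟨c • f, fun e he => hf e (MvPolynomial.support_smul he), by funext P; simp⟩

theorem pow_redq {F : Type} [Field F] [Fintype F] (x : F) (b : ℕ) :
    x ^ redq (Fintype.card F) b = x ^ b := by
  unfold redq
  split_ifs with h
  · rfl
  · obtain ⟨k, rfl⟩ := Nat.exists_eq_add_of_lt (not_le.mp h)
    have hsub : Fintype.card F - 1 + k + 1 - (Fintype.card F - 1) = k + 1 := by omega
    rw [hsub]
    rcases eq_or_ne x 0 with rfl | hx
    · simp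
    · rw [add_assoc, pow_add _ (Fintype.card F - 1), FiniteField.pow_card_sub_one_eq_one x hx,
        one_mul]

theorem monomialVec_redq {F : Type} [Field F] [Fintype F] {m : ℕ} (b : Fin m → ℕ) :
    monomialVec F (fun i => redq (Fintype.card F) (b i)) = monomialVec F b := by
  funext P
  simp only [monomialVec, pow_redq]

/-- If all reduced pairwise sums of exponents in `A` lie in `B`, then the square of the
affine code of `A` is contained in the affine code of `B`. -/
theorem squareCode_affineCode_subset (F : Type) [Field F] [Fintype F] (m : ℕ)
    (A B : Set (Fin m → ℕ))
    (h : ∀ a ∈ A, ∀ a' ∈ A, (fun i => redq (Fintype.card F) (a i + a' i)) ∈ B) :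
    squareCode F (affineCode F m A) ⊆ affineCode F m B := by
  refine Set.Subset.trans ?_ (span_subset_affineCode F m B)
  refine Submodule.span_le.mpr ?_
  rintro v ⟨c₁, h₁, c₂, h₂, rfl⟩
  have hmul := Submodule.mul_mem_mul (affineCode_subset_span F m A h₁)
    (affineCode_subset_span F m A h₂)
  rw [Submodule.span_mul_span] at hmul
  refine Submodule.span_mono ?_ hmul
  rintro _ ⟨_, ⟨a, ha, rfl⟩, _, ⟨a', ha', rfl⟩, rfl⟩
  exact ⟨_, h a ha a' ha', (monomialVec_redq (a + a')).trans (monomialVec_mul F a a').symm⟩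

theorem stmt7 (F : Type) [Field F] [Fintype F] [DecidableEq F]
    (m d : ℕ) (hm : 1 ≤ m)
    (B : Set (Fin m → ℕ)) (hBbox : ∀ b ∈ B, ∀ i, b i ≤ Fintype.card F - 1)
    (hB : ∀ v ∈ affineCode F m B, v ≠ 0 → d ≤ hammingNorm v)
    (C : Set (Fin m → ℝ)) (hconv : Convex ℝ C)
    (hint : C ∩ {c : Fin m → ℝ | ∃ b : Fin m → ℕ,
        (∀ i, (2 : ℝ) * c i = (b i : ℝ) ∧ b i ≤ 2 * Fintype.card F - 2) ∧
        (fun i => redq (Fintype.card F) (b i)) ∉ B} = ∅) :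
    ∀ v ∈ squareCode F (affineCode F m
        {a : Fin m → ℕ | (∀ i, a i ≤ Fintype.card F - 1) ∧ (fun i => (a i : ℝ)) ∈ C}),
      v ≠ 0 → d ≤ hammingNorm v := by
  refine fun v hv => hB v (squareCode_affineCode_subset F m _ B ?_ hv)
  rintro a ⟨ha, haC⟩ a' ⟨ha', haC'⟩
  by_contra hnot
  have hmid := hconv.midpoint_mem haC haC'
  refine (Set.eq_empty_iff_forall_notMem.mp hint) _
    ⟨hmid, fun i => a i + a' i, fun i => ⟨?_, ?_⟩, hnot⟩
  · simp [midpoint_eq_smul_add]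
  · have := ha i
    have := ha' i
    dsimp only
    omega
end

section
/- Let q be a prime power and d ∈ ℤ⁺ with d < q². Then the dimension of HalfHyp_q(d,2), i.e. the cardinality of the set A = {(i,j) ∈ ℕ² : 2i ≤ q−1, 2j ≤ q−1, and (q−2i)(q−2j) ≥ d}, equals Σ_{i=0}^{⌊(q²−d)/(2q)⌋} ⌊(d + (q+2)(2i−q)) / (4i−2q)⌋, where ⌊·⌋ denotes the floor of the rational number (note 4i−2q < 0 throughout the range of summation). -/
/-- The points of the half hyperbolic region, described fibrewise over the first coordinate. -/
theorem halfHyp_mem_iff {q d : ℕ} (hq : 0 < q) (hd : 1 ≤ d) (hdq : d < q ^ 2) (i j : ℕ) :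
    (2 * i ≤ q - 1 ∧ 2 * j ≤ q - 1 ∧ d ≤ (q - 2 * i) * (q - 2 * j)) ↔
      i < (q ^ 2 - d) / (2 * q) + 1 ∧
        j < (q * (q - 2 * i) - d) / (2 * (q - 2 * i)) + 1 := by
  rw [Nat.lt_succ_iff, Nat.le_div_iff_mul_le (by omega), Nat.lt_succ_iff]
  constructor
  · rintro ⟨hi, hj, h⟩
    obtain ⟨n, hn⟩ : ∃ n, q = n + 2 * i := ⟨q - 2 * i, by omega⟩
    obtain ⟨m, hm⟩ : ∃ m, q = m + 2 * j := ⟨q - 2 * j, by omega⟩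
    have en : q - 2 * i = n := by omega
    have em : q - 2 * j = m := by omega
    rw [en, em] at h
    rw [en, Nat.le_div_iff_mul_le (by omega)]
    have e₁ : q * n = n * m + j * (2 * n) := by rw [hm]; ring
    have e₂ : q ^ 2 = q * n + i * (2 * q) := by
      calc q ^ 2 = q * q := by ring
        _ = q * (n + 2 * i) := by rw [← hn]
        _ = _ := by ring
    omega
  · rintro ⟨hi, hj⟩
    have hiq : 2 * i < q := by
      by_contra! hc
      have : q * q ≤ 2 * i * q := Nat.mul_le_mul_right q hc
      have : i * (2 * q) = 2 * i * q := by ring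
      have : q ^ 2 = q * q := by ring
      omega
    obtain ⟨n, hn⟩ : ∃ n, q = n + 2 * i := ⟨q - 2 * i, by omega⟩
    have en : q - 2 * i = n := by omega
    rw [en, Nat.le_div_iff_mul_le (by omega)] at hj
    have e₂ : q ^ 2 = q * n + i * (2 * q) := by
      calc q ^ 2 = q * q := by ring
        _ = q * (n + 2 * i) := by rw [← hn]
        _ = _ := by ring
    have hjq : 2 * j < q := by
      by_contra! hc
      have : q * n ≤ 2 * j * n := Nat.mul_le_mul_right n hc
      have : j * (2 * n) = 2 * j * n := by ring
      omega
    obtain ⟨m, hm⟩ : ∃ m, q = m + 2 * j := ⟨q - 2 * j, by omega⟩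
    have em : q - 2 * j = m := by omega
    have e₁ : q * n = n * m + j * (2 * n) := by rw [hm]; ring
    rw [en, em]
    refine ⟨by omega, by omega, by omega⟩

theorem ncard_setOf_lt_lt (M : ℕ) (f : ℕ → ℕ) :
    ({p : ℕ × ℕ | p.1 < M ∧ p.2 < f p.1} : Set (ℕ × ℕ)).ncard = ∑ i ∈ Finset.range M, f i := by
  have h : ({p : ℕ × ℕ | p.1 < M ∧ p.2 < f p.1} : Set (ℕ × ℕ)) =
      (((Finset.range M).sigma fun i => Finset.range (f i)).map
        (Equiv.sigmaEquivProd ℕ ℕ).toEmbedding : Finset (ℕ × ℕ)) := by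
    ext ⟨a, b⟩
    simp [Equiv.sigmaEquivProd]
  rw [h, Set.ncard_coe_finset, Finset.card_map, Finset.card_sigma]
  simp

/-- The number of points in a fibre, as the floor of a rational number. -/
theorem halfHyp_floor_eq {q d i : ℕ} (hi : 2 * i < q) (hd : d ≤ q * (q - 2 * i)) :
    ⌊((d : ℚ) + ((q : ℚ) + 2) * (2 * (i : ℚ) - (q : ℚ))) / (4 * (i : ℚ) - 2 * (q : ℚ))⌋ =
      (((q * (q - 2 * i) - d) / (2 * (q - 2 * i)) + 1 : ℕ) : ℤ) := by
  obtain ⟨n, hn⟩ : ∃ n, q = n + 2 * i := ⟨q - 2 * i, by omega⟩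
  have en : q - 2 * i = n := by omega
  have hn0 : (n : ℚ) ≠ 0 := by
    have : n ≠ 0 := by omega
    exact_mod_cast this
  rw [en] at hd ⊢
  have e : ((d : ℚ) + ((q : ℚ) + 2) * (2 * (i : ℚ) - (q : ℚ))) / (4 * (i : ℚ) - 2 * (q : ℚ)) =
      ((q * n - d : ℕ) : ℚ) / ((2 * n : ℕ) : ℚ) + 1 := by
    have hqn : (q : ℚ) = n + 2 * i := by exact_mod_cast hn
    have h4 : 4 * (i : ℚ) - 2 * (q : ℚ) = -(2 * n) := by rw [hqn]; ring
    have h2 : 2 * (i : ℚ) - (q : ℚ) = -n := by rw [hqn]; ring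
    rw [h4, h2]
    push_cast [Nat.cast_sub hd]
    field_simp
    ring
  rw [e, Int.floor_add_one, Rat.floor_natCast_div_natCast]
  push_cast
  rfl

theorem stmt10 (F : Type) [Field F] [Fintype F]
    (d : ℕ) (hd : 1 ≤ d) (hdq : d < (Fintype.card F) ^ 2) :
    (({p : ℕ × ℕ | 2 * p.1 ≤ Fintype.card F - 1 ∧ 2 * p.2 ≤ Fintype.card F - 1 ∧
        d ≤ (Fintype.card F - 2 * p.1) * (Fintype.card F - 2 * p.2)} : Set (ℕ × ℕ)).ncard : ℤ) =
      ∑ i ∈ Finset.range (((Fintype.card F) ^ 2 - d) / (2 * Fintype.card F) + 1),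
        ⌊((d : ℚ) + ((Fintype.card F : ℚ) + 2) * (2 * (i : ℚ) - (Fintype.card F : ℚ))) /
          (4 * (i : ℚ) - 2 * (Fintype.card F : ℚ))⌋ := by
  have hq : 0 < Fintype.card F := Fintype.card_pos
  generalize Fintype.card F = q at *
  simp_rw [halfHyp_mem_iff hq hd hdq]
  rw [ncard_setOf_lt_lt _ fun i => (q * (q - 2 * i) - d) / (2 * (q - 2 * i)) + 1, Nat.cast_sum]
  refine Finset.sum_congr rfl fun i hi => ?_
  obtain ⟨h₁, -, h₂⟩ := (halfHyp_mem_iff hq hd hdq i 0).2 ⟨Finset.mem_range.1 hi, Nat.succ_pos _⟩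
  refine (halfHyp_floor_eq (by omega) ?_).symm
  simpa [mul_comm] using h₂
end

section
/- Let q be a prime power and d ∈ ℤ⁺ even with d < q, and set s = q − d/2. Define B₁ = {(i,j) ∈ ℕ² : i+j < s} ∪ {(i,j) ∈ ℕ² : i+j = s and 2j < q−d+1} and B₂ = {(i,j) ∈ ℕ² : i+j < s} ∪ {(i,j) ∈ ℕ² : i+j = s and 2i < q−d+1}. Then each of B₁ and B₂ is of the form {(i,j) ∈ [0,q−1]² : w₁ i + w₂ j ≤ λ} for some positive reals w₁, w₂, λ (so C_{B₁} and C_{B₂} are weighted Reed-Muller codes), and the cardinalities of B₁ and B₂ are equal. -/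
theorem add_lt_or_eq_iff_weighted_le {s m Q i j : ℕ} (hm : 1 ≤ m) (hms : (m - 1) / 2 ≤ s)
    (hsQ : s ≤ Q) :
    (i + j < s ∨ i + j = s ∧ 2 * j < m) ↔
      (i ≤ Q ∧ j ≤ Q) ∧ (s + 1) * i + (s + 2) * j ≤ s * (s + 1) + (m - 1) / 2 := by
  have key : (s + 1) * i + (s + 2) * j = (i + j) * (s + 1) + j := by ring
  rw [key]
  rcases lt_trichotomy (i + j) s with h | h | h
  · have h1 : (i + j + 1) * (s + 1) ≤ s * (s + 1) := Nat.mul_le_mul_right _ h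
    rw [add_one_mul] at h1
    omega
  · rw [h]
    omega
  · have h1 : (s + 1) * (s + 1) ≤ (i + j) * (s + 1) := Nat.mul_le_mul_right _ h
    rw [add_one_mul s (s + 1)] at h1
    omega

theorem exists_weights_of_forall_mem_iff {B : Set (Fin 2 → ℕ)} {Q w₁ w₂ l : ℕ}
    (hw₁ : 0 < w₁) (hw₂ : 0 < w₂) (hl : 0 < l)
    (hB : ∀ a, a ∈ B ↔ (a 0 ≤ Q ∧ a 1 ≤ Q) ∧ w₁ * a 0 + w₂ * a 1 ≤ l) :
    ∃ w₁ w₂ lam : ℝ, 0 < w₁ ∧ 0 < w₂ ∧ 0 < lam ∧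
      B = {a : Fin 2 → ℕ | (∀ i, a i ≤ Q) ∧ w₁ * (a 0 : ℝ) + w₂ * (a 1 : ℝ) ≤ lam} := by
  refine ⟨w₁, w₂, l, by exact_mod_cast hw₁, by exact_mod_cast hw₂, by exact_mod_cast hl, ?_⟩
  ext a
  rw [hB, Set.mem_ofPred_eq, Fin.forall_fin_two]
  exact and_congr_right fun _ => by norm_cast

theorem stmt12 (F : Type) [Field F] [Fintype F]
    (d : ℕ) (hd : 1 ≤ d) (heven : Even d) (hdq : d < Fintype.card F)
    (s : ℕ) (hsdef : s = Fintype.card F - d / 2)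
    (B₁ B₂ : Set (Fin 2 → ℕ))
    (hB₁ : B₁ = {a : Fin 2 → ℕ | a 0 + a 1 < s} ∪
        {a : Fin 2 → ℕ | a 0 + a 1 = s ∧ 2 * a 1 < Fintype.card F - d + 1})
    (hB₂ : B₂ = {a : Fin 2 → ℕ | a 0 + a 1 < s} ∪
        {a : Fin 2 → ℕ | a 0 + a 1 = s ∧ 2 * a 0 < Fintype.card F - d + 1}) :
    (∃ w₁ w₂ lam : ℝ, 0 < w₁ ∧ 0 < w₂ ∧ 0 < lam ∧
        B₁ = {a : Fin 2 → ℕ | (∀ i, a i ≤ Fintype.card F - 1) ∧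
          w₁ * (a 0 : ℝ) + w₂ * (a 1 : ℝ) ≤ lam}) ∧
    (∃ w₁ w₂ lam : ℝ, 0 < w₁ ∧ 0 < w₂ ∧ 0 < lam ∧
        B₂ = {a : Fin 2 → ℕ | (∀ i, a i ≤ Fintype.card F - 1) ∧
          w₁ * (a 0 : ℝ) + w₂ * (a 1 : ℝ) ≤ lam}) ∧
    B₁.ncard = B₂.ncard := by
  have hd2 : 1 ≤ d / 2 := by
    obtain ⟨r, rfl⟩ := heven
    omega
  have hm : 1 ≤ Fintype.card F - d + 1 := by omega
  have hms : (Fintype.card F - d + 1 - 1) / 2 ≤ s := by omega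
  have hsQ : s ≤ Fintype.card F - 1 := by omega
  have hl : 0 < s * (s + 1) + (Fintype.card F - d + 1 - 1) / 2 := by
    have : 0 < s * (s + 1) := Nat.mul_pos (by omega) s.succ_pos
    omega
  refine ⟨exists_weights_of_forall_mem_iff (w₁ := s + 1) (w₂ := s + 2) (by omega) (by omega) hl
      fun a => ?_,
    exists_weights_of_forall_mem_iff (w₁ := s + 2) (w₂ := s + 1) (by omega) (by omega) hl
      fun a => ?_, ?_⟩
  · rw [hB₁]
    exact add_lt_or_eq_iff_weighted_le hm hms hsQ
  · rw [hB₂, add_comm ((s + 2) * a 0), and_comm (a := a 0 ≤ _),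
      ← add_lt_or_eq_iff_weighted_le hm hms hsQ, add_comm (a 1)]
    rfl
  · let e : (Fin 2 → ℕ) ≃ (Fin 2 → ℕ) := (Equiv.swap 0 1).arrowCongr (Equiv.refl ℕ)
    have hB : B₁ = e ⁻¹' B₂ := by
      ext a
      simp [hB₁, hB₂, e, Equiv.arrowCongr, add_comm]
    rw [hB, ← e.image_symm_eq_preimage, Set.ncard_image_of_injective _ e.symm.injective]
end

section
/- Let q be a prime power and d ∈ ℤ⁺ even with d < q, and set s = q − d/2 and B₁ = {(i,j) ∈ ℕ² : i+j < s} ∪ {(i,j) ∈ ℕ² : i+j = s and 2j < q−d+1}. Let w₁, w₂, λ be positive reals and A = {(i,j) ∈ [0,q−1]² : w₁ i + w₂ j ≤ λ}. If every nonzero codeword of the square code C_A^{(2)} has Hamming weight at least d, then the cardinality of A is at most the cardinality of B₁. -/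
open MvPolynomial in
/-- The product of the linear factors `X 0 - c`, `c ∈ S`, and `X 1 - c`, `c ∈ T`. -/
noncomputable def gridPoly {F : Type} [Field F] (S T : Finset F) : MvPolynomial (Fin 2) F :=
  (∏ c ∈ S, (X 0 - C c)) * ∏ c ∈ T, (X 1 - C c)

open MvPolynomial in
lemma degreeOf_prod_X_sub_C_le {F : Type} [Field F] (i j : Fin 2) (S : Finset F) :
    degreeOf i (∏ c ∈ S, (X j - C c) : MvPolynomial (Fin 2) F) ≤ if i = j then S.card else 0 := by
  refine (degreeOf_prod_le i S _).trans ?_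
  have h : ∀ c ∈ S, degreeOf i (X j - C c : MvPolynomial (Fin 2) F) ≤ if i = j then 1 else 0 := by
    intro c _
    refine (degreeOf_sub_le i _ _).trans ?_
    rw [degreeOf_X, degreeOf_C]
    simp
  refine (Finset.sum_le_sum h).trans ?_
  split_ifs <;> simp

lemma gridPoly_support_le {F : Type} [Field F] (S T : Finset F) (e : Fin 2 →₀ ℕ)
    (he : e ∈ (gridPoly S T).support) : e 0 ≤ S.card ∧ e 1 ≤ T.card := by
  have key : ∀ i : Fin 2, e i ≤ (if i = 0 then S.card else 0) + if i = 1 then T.card else 0 :=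
    fun i => ((MvPolynomial.degreeOf_le_iff.mp le_rfl) e he).trans
      ((MvPolynomial.degreeOf_mul_le i _ _).trans
        (add_le_add (degreeOf_prod_X_sub_C_le i 0 S) (degreeOf_prod_X_sub_C_le i 1 T)))
  exact ⟨by simpa using key 0, by simpa using key 1⟩

lemma gridPoly_eval_ne_zero_iff {F : Type} [Field F] (S T : Finset F) (P : Fin 2 → F) :
    MvPolynomial.eval P (gridPoly S T) ≠ 0 ↔ P 0 ∉ S ∧ P 1 ∉ T := by
  simp [gridPoly, Finset.prod_eq_zero_iff, sub_eq_zero]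

/-- If `A` is closed downwards and `a, b ∈ A` have `a + b` in the box `[0, q - 1]²`, then the
square code contains a nonzero word of weight `(q - (a 0 + b 0)) * (q - (a 1 + b 1))`. -/
lemma exists_mem_squareCode_hammingNorm_eq (F : Type) [Field F] [Fintype F] [DecidableEq F]
    (A : Set (Fin 2 → ℕ)) (hA : IsLowerSet A) {a b : Fin 2 → ℕ} (ha : a ∈ A) (hb : b ∈ A)
    (hab : ∀ i, a i + b i < Fintype.card F) :
    ∃ v ∈ squareCode F (affineCode F 2 A), v ≠ 0 ∧
      hammingNorm v = (Fintype.card F - (a 0 + b 0)) * (Fintype.card F - (a 1 + b 1)) := by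
  have split : ∀ i, ∃ S T : Finset F, S.card = a i ∧ T.card = b i ∧
      (S ∪ T).card = a i + b i := by
    intro i
    obtain ⟨U, -, hU⟩ := Finset.exists_subset_card_eq
      (s := (Finset.univ : Finset F)) (n := a i + b i) (hab i).le
    obtain ⟨S, hSU, hS⟩ := Finset.exists_subset_card_eq (s := U) (n := a i) (by omega)
    refine ⟨S, U \ S, hS, ?_, ?_⟩
    · rw [Finset.card_sdiff_of_subset hSU]; omega
    · rw [Finset.union_sdiff_of_subset hSU, hU]
  obtain ⟨S, S', hS, hS', hSS⟩ := split 0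
  obtain ⟨T, T', hT, hT', hTT⟩ := split 1
  have mem : ∀ (S T : Finset F) (c : Fin 2 → ℕ), c ∈ A → S.card = c 0 → T.card = c 1 →
      (fun P => MvPolynomial.eval P (gridPoly S T)) ∈ affineCode F 2 A := by
    intro S T c hc h0 h1
    refine ⟨_, fun e he => hA ?_ hc, rfl⟩
    have := gridPoly_support_le S T e he
    intro i
    fin_cases i
    · exact this.1.trans h0.le
    · exact this.2.trans h1.le
  set v : (Fin 2 → F) → F := (fun P => MvPolynomial.eval P (gridPoly S T)) *
    fun P => MvPolynomial.eval P (gridPoly S' T') with hv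
  have hvP : ∀ P, v P ≠ 0 ↔ P 0 ∈ (S ∪ S')ᶜ ∧ P 1 ∈ (T ∪ T')ᶜ := by
    intro P
    rw [hv, Pi.mul_apply, mul_ne_zero_iff, gridPoly_eval_ne_zero_iff, gridPoly_eval_ne_zero_iff]
    simp only [Finset.mem_compl, Finset.mem_union]
    tauto
  have hnorm : hammingNorm v =
      (Fintype.card F - (a 0 + b 0)) * (Fintype.card F - (a 1 + b 1)) := by
    have : (Finset.univ.filter fun P => v P ≠ 0) =
        Fintype.piFinset ![(S ∪ S')ᶜ, (T ∪ T')ᶜ] := by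
      ext P
      simp only [Finset.mem_filter, Finset.mem_univ, true_and, hvP, Fintype.mem_piFinset,
        Fin.forall_fin_two, Matrix.cons_val_zero, Matrix.cons_val_one]
    rw [hammingNorm, this, Fintype.card_piFinset, Fin.prod_univ_two]
    simp only [Matrix.cons_val_zero, Matrix.cons_val_one, Finset.card_compl, hSS, hTT]
  refine ⟨v, Submodule.subset_span ⟨_, mem S T a ha hS hT, _, mem S' T' b hb hS' hT', rfl⟩, ?_,
    hnorm⟩
  rw [← hammingNorm_ne_zero_iff, hnorm]
  have h0 := hab 0
  have h1 := hab 1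
  exact Nat.mul_ne_zero (by omega) (by omega)

/-- The lattice points `(x, y)` with `x + y < n`. -/
def latticeTriangle (n : ℕ) : Finset (ℕ × ℕ) :=
  (Finset.range n).biUnion fun k => Finset.HasAntidiagonal.antidiagonal k

lemma mem_latticeTriangle {n : ℕ} {a : ℕ × ℕ} : a ∈ latticeTriangle n ↔ a.1 + a.2 < n := by
  simp [latticeTriangle]

lemma two_mul_card_latticeTriangle (n : ℕ) : 2 * (latticeTriangle n).card = n * (n + 1) := by
  rw [latticeTriangle, Finset.card_biUnion]
  · induction n with
    | zero => simp
    | succ k ih =>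
      rw [Finset.sum_range_succ, mul_add, ih, Finset.Nat.card_antidiagonal]
      ring
  · intro i _ j _ hij
    refine Finset.disjoint_left.mpr fun a ha hb => ?_
    simp only [Finset.HasAntidiagonal.mem_antidiagonal] at ha hb
    omega

/-- The lattice points of the box `[0, q - 1]²` of weight at most `lam`. -/
noncomputable def weightedBox (q : ℕ) (w₁ w₂ lam : ℝ) : Finset (ℕ × ℕ) :=
  open Classical in
  (Finset.range q ×ˢ Finset.range q).filter fun a => w₁ * (a.1 : ℝ) + w₂ * (a.2 : ℝ) ≤ lam

lemma mem_weightedBox {q : ℕ} {w₁ w₂ lam : ℝ} {a : ℕ × ℕ} :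
    a ∈ weightedBox q w₁ w₂ lam ↔
      (a.1 < q ∧ a.2 < q) ∧ w₁ * (a.1 : ℝ) + w₂ * (a.2 : ℝ) ≤ lam := by
  simp [weightedBox]

/-- A set of lattice points containing no two points with sum `(k, l)` has at most half of the
points of the rectangle `[0, k] × [0, l]`. -/
lemma two_mul_card_filter_le {A : Finset (ℕ × ℕ)} {k l : ℕ} (hk : ∀ a ∈ A, a.1 ≤ k)
    (h : ∀ a ∈ A, ∀ b ∈ A, a + b ≠ (k, l)) :
    2 * (A.filter fun a => a.2 ≤ l).card ≤ (k + 1) * (l + 1) := by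
  set R := A.filter fun a => a.2 ≤ l with hR
  have hRmem : ∀ a ∈ R, a ∈ A ∧ a.1 ≤ k ∧ a.2 ≤ l := fun a ha => by
    rw [hR, Finset.mem_filter] at ha
    exact ⟨ha.1, hk a ha.1, ha.2⟩
  set R' := R.image fun a => (k - a.1, l - a.2) with hR'
  have hcard : R'.card = R.card := by
    refine Finset.card_image_of_injOn fun a ha b hb hab => ?_
    have h1 := hRmem a ha
    have h2 := hRmem b hb
    simp only [Prod.mk.injEq] at hab
    ext <;> omega
  have hdisj : Disjoint R R' := by
    rw [Finset.disjoint_left]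
    intro b hb hb'
    obtain ⟨a, ha, rfl⟩ := Finset.mem_image.mp hb'
    have h1 := hRmem a ha
    refine h a h1.1 _ (hRmem _ hb).1 ?_
    ext <;> simp <;> omega
  have hsub : R ∪ R' ⊆ Finset.range (k + 1) ×ˢ Finset.range (l + 1) := by
    intro b hb
    rw [Finset.mem_product, Finset.mem_range, Finset.mem_range]
    rcases Finset.mem_union.mp hb with hb | hb
    · have := hRmem b hb
      omega
    · obtain ⟨a, -, rfl⟩ := Finset.mem_image.mp hb
      simp only
      omega
  have := Finset.card_le_card hsub
  rw [Finset.card_union_of_disjoint hdisj, hcard, Finset.card_product, Finset.card_range,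
    Finset.card_range] at this
  omega

lemma two_mul_card_weightedBox_le {q m : ℕ} (hm : 1 ≤ m) (hq : 2 * m < q) {w₁ w₂ lam : ℝ}
    (hw₁ : 0 < w₁) (hw : w₁ ≤ w₂)
    (h : ∀ a ∈ weightedBox q w₁ w₂ lam, ∀ b ∈ weightedBox q w₁ w₂ lam,
      a + b ≠ (q - 1, q + 1 - 2 * m)) :
    2 * (weightedBox q w₁ w₂ lam).card ≤ q * (q + 2 - 2 * m) + (m - 2) * (m - 1) := by
  classical
  set A := weightedBox q w₁ w₂ lam with hA
  have hlow := two_mul_card_filter_le (A := A) (k := q - 1) (l := q + 1 - 2 * m)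
    (fun a ha => by have := (mem_weightedBox.mp ha).1; omega) h
  rw [show q - 1 + 1 = q by omega, show q + 1 - 2 * m + 1 = q + 2 - 2 * m by omega] at hlow
  have hhigh : 2 * (A.filter fun a => ¬ a.2 ≤ q + 1 - 2 * m).card ≤ (m - 2) * (m - 1) := by
    have key : ∀ a ∈ A, ¬ a.2 ≤ q + 1 - 2 * m →
        a.1 + (a.2 - (q + 2 - 2 * m)) < m - 2 := by
      rintro ⟨x, y⟩ ha hy
      by_contra hlt
      obtain ⟨⟨hx, hyq⟩, hwt⟩ := mem_weightedBox.mp ha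
      simp only at hx hyq hwt hy hlt
      have hsum : (q : ℝ) ≤ x + y + m := by exact_mod_cast (by omega : q ≤ x + y + m)
      have hy' : (q : ℝ) + 2 ≤ y + 2 * m := by exact_mod_cast (by omega : q + 2 ≤ y + 2 * m)
      have hq' : 2 * (m : ℝ) < q := by exact_mod_cast hq
      have hx0 : (0 : ℝ) ≤ x := x.cast_nonneg
      refine h (q - m, 0) (mem_weightedBox.mpr ⟨⟨by simp; omega, by simp; omega⟩, ?_⟩)
        (m - 1, q + 1 - 2 * m) (mem_weightedBox.mpr ⟨⟨by simp; omega, by simp; omega⟩, ?_⟩) ?_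
      · push_cast [show m ≤ q by omega]
        nlinarith
      · push_cast [hm, show 2 * m ≤ q + 1 by omega]
        nlinarith
      · ext <;> simp <;> omega
    rcases Nat.lt_or_ge m 2 with hm2 | hm2
    · have : (A.filter fun a => ¬ a.2 ≤ q + 1 - 2 * m) = ∅ :=
        Finset.filter_eq_empty_iff.mpr fun a ha hy => by have := key a ha hy; omega
      rw [this]
      simp
    · have : (A.filter fun a => ¬ a.2 ≤ q + 1 - 2 * m).card ≤ (latticeTriangle (m - 2)).card := by
        refine Finset.card_le_card_of_injOn (fun a => (a.1, a.2 - (q + 2 - 2 * m))) ?_ ?_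
        · intro a ha
          rw [Finset.mem_coe, Finset.mem_filter] at ha
          exact mem_latticeTriangle.mpr (key a ha.1 ha.2)
        · intro a ha b hb hab
          rw [Finset.mem_coe, Finset.mem_filter] at ha hb
          simp only [Prod.mk.injEq] at hab
          ext <;> omega
      have h2 := two_mul_card_latticeTriangle (m - 2)
      rw [show m - 2 + 1 = m - 1 by omega] at h2
      omega
  have := Finset.card_filter_add_card_filter_not (s := A) (fun a => a.2 ≤ q + 1 - 2 * m)
  omega

lemma card_weightedBox_swap (q : ℕ) (w₁ w₂ lam : ℝ) :
    (weightedBox q w₂ w₁ lam).card = (weightedBox q w₁ w₂ lam).card := by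
  refine Finset.card_bij' (fun a _ => a.swap) (fun a _ => a.swap) ?_ ?_
    (fun _ _ => Prod.swap_swap _) (fun _ _ => Prod.swap_swap _)
  all_goals
    intro a ha
    rw [mem_weightedBox] at ha ⊢
    exact ⟨⟨ha.1.2, ha.1.1⟩, by simpa [add_comm] using ha.2⟩

/-- The lattice points below the diagonal `x + y = s`, with the points `(s - j, j)`, `j ≤ k`,
of the diagonal. -/
def truncatedTriangle (s k : ℕ) : Finset (ℕ × ℕ) :=
  latticeTriangle s ∪ (Finset.range (k + 1)).image fun j => (s - j, j)

lemma mem_truncatedTriangle {s k : ℕ} (hk : k ≤ s) {a : ℕ × ℕ} :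
    a ∈ truncatedTriangle s k ↔ a.1 + a.2 < s ∨ a.1 + a.2 = s ∧ a.2 ≤ k := by
  rw [truncatedTriangle, Finset.mem_union, mem_latticeTriangle, Finset.mem_image]
  refine or_congr_right ⟨?_, fun h => ⟨a.2, ?_, ?_⟩⟩
  · rintro ⟨j, hj, rfl⟩
    rw [Finset.mem_range] at hj
    simp only
    omega
  · rw [Finset.mem_range]
    omega
  · ext <;> simp only
    omega

lemma two_mul_card_truncatedTriangle {s k : ℕ} (hk : k ≤ s) :
    2 * (truncatedTriangle s k).card = s * (s + 1) + 2 * (k + 1) := by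
  rw [truncatedTriangle, Finset.card_union_of_disjoint, mul_add, two_mul_card_latticeTriangle,
    Finset.card_image_of_injective _ fun i j hij => (Prod.mk.inj hij).2, Finset.card_range]
  rw [Finset.disjoint_left]
  intro a ha hb
  obtain ⟨j, hj, rfl⟩ := Finset.mem_image.mp hb
  rw [Finset.mem_range] at hj
  have := mem_latticeTriangle.mp ha
  simp only at this
  omega

lemma ncard_eq_card_of_mem_iff {S : Set (Fin 2 → ℕ)} {T : Finset (ℕ × ℕ)}
    (h : ∀ a, a ∈ S ↔ (a 0, a 1) ∈ T) : S.ncard = T.card := by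
  have : S = ↑(T.map (finTwoArrowEquiv ℕ).symm.toEmbedding) := by
    ext a
    rw [Finset.mem_coe, Finset.mem_map_equiv, h]
    rfl
  rw [this, Set.ncard_coe_finset, Finset.card_map]

theorem stmt14 (F : Type) [Field F] [Fintype F] [DecidableEq F]
    (d : ℕ) (hd : 1 ≤ d) (heven : Even d) (hdq : d < Fintype.card F)
    (s : ℕ) (hsdef : s = Fintype.card F - d / 2)
    (B₁ : Set (Fin 2 → ℕ))
    (hB₁ : B₁ = {a : Fin 2 → ℕ | a 0 + a 1 < s} ∪
        {a : Fin 2 → ℕ | a 0 + a 1 = s ∧ 2 * a 1 < Fintype.card F - d + 1})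
    (w₁ w₂ lam : ℝ) (hw₁ : 0 < w₁) (hw₂ : 0 < w₂) (hlam : 0 < lam)
    (A : Set (Fin 2 → ℕ))
    (hA : A = {a : Fin 2 → ℕ | (∀ i, a i ≤ Fintype.card F - 1) ∧
        w₁ * (a 0 : ℝ) + w₂ * (a 1 : ℝ) ≤ lam})
    (hsq : ∀ v ∈ squareCode F (affineCode F 2 A), v ≠ 0 → d ≤ hammingNorm v) :
    A.ncard ≤ B₁.ncard := by
  obtain ⟨m, hm⟩ := heven
  set q := Fintype.card F with hq
  have hdm : d / 2 = m := by omega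
  have hlower : IsLowerSet A := by
    rw [hA]
    intro a b hba ha
    have h0 : (b 0 : ℝ) ≤ a 0 := by exact_mod_cast hba 0
    have h1 : (b 1 : ℝ) ≤ a 1 := by exact_mod_cast hba 1
    exact ⟨fun i => (hba i).trans (ha.1 i), le_trans (by gcongr) ha.2⟩
  have hAmem : ∀ a, a ∈ A ↔ (a 0, a 1) ∈ weightedBox q w₁ w₂ lam := by
    intro a
    rw [mem_weightedBox, hA, Set.mem_ofPred_eq, Fin.forall_fin_two]
    refine and_congr_left fun _ => ?_
    simp only
    omega
  have hBmem : ∀ a, a ∈ B₁ ↔ (a 0, a 1) ∈ truncatedTriangle s ((q - d) / 2) := by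
    intro a
    rw [mem_truncatedTriangle (by omega), hB₁, Set.mem_union, Set.mem_ofPred_eq, Set.mem_ofPred_eq]
    simp only
    omega
  have hweight : ∀ a ∈ weightedBox q w₁ w₂ lam, ∀ b ∈ weightedBox q w₁ w₂ lam,
      a.1 + b.1 < q → a.2 + b.2 < q → d ≤ (q - (a.1 + b.1)) * (q - (a.2 + b.2)) := by
    intro a ha b hb h1 h2
    obtain ⟨v, hv, hv0, hnorm⟩ := exists_mem_squareCode_hammingNorm_eq F A hlower
      (a := ![a.1, a.2]) (b := ![b.1, b.2]) ((hAmem _).mpr ha) ((hAmem _).mpr hb)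
      (Fin.forall_fin_two.mpr ⟨h1, h2⟩)
    have := hsq v hv hv0
    rw [hnorm] at this
    exact this
  have hbound : 2 * (weightedBox q w₁ w₂ lam).card ≤ q * (q + 2 - 2 * m) + (m - 2) * (m - 1) := by
    rcases le_total w₁ w₂ with hw | hw
    · refine two_mul_card_weightedBox_le (by omega) (by omega) hw₁ hw fun a ha b hb hab => ?_
      have h1 : a.1 + b.1 = q - 1 := congrArg Prod.fst hab
      have h2 : a.2 + b.2 = q + 1 - 2 * m := congrArg Prod.snd hab
      have := hweight a ha b hb (by omega) (by omega)
      rw [h1, h2, show q - (q - 1) = 1 by omega] at this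
      omega
    · rw [← card_weightedBox_swap]
      refine two_mul_card_weightedBox_le (by omega) (by omega) hw₂ hw fun a ha b hb hab => ?_
      have h1 : a.1 + b.1 = q - 1 := congrArg Prod.fst hab
      have h2 : a.2 + b.2 = q + 1 - 2 * m := congrArg Prod.snd hab
      have hswap : ∀ c ∈ weightedBox q w₂ w₁ lam, c.swap ∈ weightedBox q w₁ w₂ lam := by
        intro c hc
        rw [mem_weightedBox] at hc ⊢
        exact ⟨⟨hc.1.2, hc.1.1⟩, by simpa [add_comm] using hc.2⟩
      have := hweight _ (hswap a ha) _ (hswap b hb) (by simp; omega) (by simp; omega)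
      simp only [Prod.fst_swap, Prod.snd_swap] at this
      rw [h1, h2, show q - (q - 1) = 1 by omega] at this
      omega
  rw [ncard_eq_card_of_mem_iff hAmem, ncard_eq_card_of_mem_iff hBmem]
  have hB := two_mul_card_truncatedTriangle (s := s) (k := (q - d) / 2) (by omega)
  obtain ⟨r, hr⟩ : ∃ r, q = 2 * m + r := ⟨q - 2 * m, by omega⟩
  have hs : s = m + r := by omega
  rw [show q + 2 - 2 * m = r + 2 by omega] at hbound
  have hk : r ≤ 2 * ((q - d) / 2) + 1 := by omega
  have hident : q * (r + 2) + (m - 2) * (m - 1) = s * (s + 1) + (r + 2) := by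
    rw [hr, hs]
    obtain ⟨n, rfl⟩ : ∃ n, m = n + 1 := ⟨m - 1, by omega⟩
    rcases n with _ | n
    · simp; ring
    · simp only [Nat.add_sub_cancel, show n + 1 + 1 - 2 = n by omega]
      ring
  omega
end

section
/- Let q be a prime power and d ∈ ℤ⁺ odd with d < (2−√2)q. Then the cardinality of {(i,j) ∈ [0,q−1]² : i+j ≤ q−(d−1)/2} is strictly greater than the cardinality of {(i,j) ∈ ℕ² : 2i ≤ q−1, 2j ≤ q−1, and (q−2i)(q−2j) ≥ d}; equivalently, k(RM_q(q−(d−1)/2, 2)) > k(HalfHyp_q(d,2)). -/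
/-- The lattice points of a triangle of side `t` number at least `(t + 1) (t + 2) / 2`. -/
theorem triangle_le_two_mul_ncard {S : Set (Fin 2 → ℕ)} (hS : S.Finite) (t : ℕ)
    (h : ∀ a : Fin 2 → ℕ, a 0 + a 1 ≤ t → a ∈ S) :
    (t + 1) * (t + 2) ≤ 2 * S.ncard := by
  let T : Finset (Σ _ : ℕ, ℕ) := (Finset.range (t + 1)).sigma fun n => Finset.range (n + 1)
  have hT : T.card * 2 = (t + 1) * (t + 2) := by
    have h1 : T.card = ∑ n ∈ Finset.range (t + 2), n := by
      simp [T, Finset.card_sigma, Finset.sum_range_succ' (fun n => n) (t + 1)]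
    rw [h1, Finset.sum_range_id_mul_two]
    simp [mul_comm]
  have hle : T.card ≤ S.ncard := by
    rw [← Set.ncard_coe_finset T]
    refine Set.ncard_le_ncard_of_injOn (fun x => ![x.2, x.1 - x.2]) ?_ ?_ hS
    · rintro ⟨n, k⟩ hx
      simp only [T, Finset.coe_sigma, Set.mem_sigma_iff, Finset.coe_range, Set.mem_Iio] at hx
      apply h
      simp
      omega
    · rintro ⟨n, k⟩ hx ⟨n', k'⟩ hx' he
      simp only [T, Finset.coe_sigma, Set.mem_sigma_iff, Finset.coe_range, Set.mem_Iio] at hx hx'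
      have h0 := congrFun he 0
      have h1 := congrFun he 1
      simp at h0 h1
      obtain rfl : n = n' := by omega
      rw [h0]
  omega

/-- A set of lattice points in the box `[0, m - 1]²` has at most `m²` elements. -/
theorem ncard_le_sq_of_forall_lt {S : Set (Fin 2 → ℕ)} (m : ℕ)
    (h : ∀ a ∈ S, ∀ i, a i < m) : S.Finite ∧ S.ncard ≤ m ^ 2 := by
  have hsub : S ⊆ (Fintype.piFinset fun _ : Fin 2 => Finset.range m : Finset (Fin 2 → ℕ)) := by
    intro a ha
    simpa using h a ha
  refine ⟨(Finset.finite_toSet _).subset hsub, ?_⟩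
  have := Set.ncard_le_ncard hsub (Finset.finite_toSet _)
  rw [Set.ncard_coe_finset] at this
  simpa using this

theorem stmt15 (F : Type) [Field F] [Fintype F]
    (d : ℕ) (hd : 1 ≤ d) (hodd : Odd d)
    (hdq : (d : ℝ) < (2 - Real.sqrt 2) * (Fintype.card F : ℝ)) :
    ({a : Fin 2 → ℕ | (∀ i, a i ≤ Fintype.card F - 1) ∧
        a 0 + a 1 ≤ Fintype.card F - (d - 1) / 2} : Set (Fin 2 → ℕ)).ncard >
      ({a : Fin 2 → ℕ | (∀ i, 2 * a i ≤ Fintype.card F - 1) ∧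
        d ≤ (Fintype.card F - 2 * a 0) * (Fintype.card F - 2 * a 1)} :
          Set (Fin 2 → ℕ)).ncard := by
  have hq : 2 ≤ Fintype.card F := Fintype.one_lt_card
  generalize Fintype.card F = q at *
  obtain ⟨k, rfl⟩ := hodd
  rw [show (2 * k + 1 - 1) / 2 = k by omega]
  have hqR : (2 : ℝ) ≤ q := by exact_mod_cast hq
  have hs2 : Real.sqrt 2 ^ 2 = 2 := Real.sq_sqrt (by norm_num)
  have hs1 : 1 ≤ Real.sqrt 2 := Real.one_le_sqrt.2 (by norm_num)
  push_cast at hdq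
  have hlin : Real.sqrt 2 * q < 2 * q - 2 * k - 1 := by linarith
  have hkq : 2 * k + 1 < q := by
    have : (2 * k + 1 : ℝ) < q := by nlinarith
    exact_mod_cast this
  obtain ⟨s, rfl⟩ : ∃ s, q = s + k := ⟨q - k, by omega⟩
  rw [Nat.add_sub_cancel]
  push_cast at hlin hqR
  have hsq : 2 * ((s : ℝ) + k) ^ 2 < (2 * s - 1) ^ 2 := by
    have h0 : 0 ≤ Real.sqrt 2 * ((s : ℝ) + k) := by positivity
    calc 2 * ((s : ℝ) + k) ^ 2 = (Real.sqrt 2 * (s + k)) ^ 2 := by rw [mul_pow, hs2]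
      _ < (2 * (s : ℝ) - 1) ^ 2 := pow_lt_pow_left₀ (by linarith) h0 (by norm_num)
  have hsqZ : 2 * ((s : ℤ) + k) ^ 2 < (2 * s - 1) ^ 2 := by exact_mod_cast hsq
  obtain ⟨-, hbox⟩ := ncard_le_sq_of_forall_lt
    (S := {a : Fin 2 → ℕ | (∀ i, 2 * a i ≤ s + k - 1) ∧
      2 * k + 1 ≤ (s + k - 2 * a 0) * (s + k - 2 * a 1)}) ((s + k + 1) / 2)
    fun a ha i => by have := ha.1 i; omega
  obtain ⟨hfin, -⟩ := ncard_le_sq_of_forall_lt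
    (S := {a : Fin 2 → ℕ | (∀ i, a i ≤ s + k - 1) ∧ a 0 + a 1 ≤ s}) (s + k)
    fun a ha i => by have := ha.1 i; omega
  have htri := triangle_le_two_mul_ncard hfin (min s (s + k - 1)) fun a ha =>
    ⟨Fin.forall_fin_two.2 ⟨by omega, by omega⟩, by omega⟩
  refine lt_of_le_of_lt hbox ?_
  have hm : 2 * ((s + k + 1) / 2) ≤ s + k + 1 := Nat.mul_div_le _ _
  generalize (s + k + 1) / 2 = m at *
  have hm2 : (2 * m) ^ 2 ≤ (s + k + 1) ^ 2 := Nat.pow_le_pow_left hm 2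
  rcases Nat.eq_zero_or_pos k with rfl | hk
  · obtain ⟨r, rfl⟩ : ∃ r, s = r + 1 := ⟨s - 1, by omega⟩
    rw [show min (r + 1) (r + 1 + 0 - 1) = r by omega] at htri
    nlinarith
  · rw [show min s (s + k - 1) = s by omega] at htri
    zify at *
    nlinarith
end

section
/- Let q be a prime power and d ∈ ℤ⁺ even with d < (2−√2)q, and set s = q − d/2 and B₁ = {(i,j) ∈ ℕ² : i+j < s} ∪ {(i,j) ∈ ℕ² : i+j = s and 2j < q−d+1}. Then the cardinality of B₁ is strictly greater than the cardinality of {(i,j) ∈ ℕ² : 2i ≤ q−1, 2j ≤ q−1, and (q−2i)(q−2j) ≥ d}; equivalently, k(C_{B₁}) > k(HalfHyp_q(d,2)). -/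
/-- The triangle `a 0 + a 1 < s` together with `t` points of its hypotenuse has at least
`s * (s + 1) / 2 + t` points. -/
theorem le_two_mul_ncard_of_triangle_subset (s t : ℕ) (ht : t ≤ s + 1) (B : Set (Fin 2 → ℕ))
    (hfin : B.Finite) (hlt : ∀ a : Fin 2 → ℕ, a 0 + a 1 < s → a ∈ B)
    (heq : ∀ a : Fin 2 → ℕ, a 0 + a 1 = s → a 1 < t → a ∈ B) :
    s * (s + 1) + 2 * t ≤ 2 * B.ncard := by
  classical
  set P : Finset (Σ _ : ℕ, ℕ) :=
    (Finset.range (s + 1)).sigma fun n => Finset.range (if n < s then n + 1 else t) with hP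
  have hmem : ∀ x : Σ _ : ℕ, ℕ, x ∈ P → x.2 ≤ x.1 ∧ (x.1 < s ∨ x.1 = s ∧ x.2 < t) := by
    rintro ⟨n, j⟩ hx
    simp only [hP, Finset.mem_sigma, Finset.mem_range] at hx
    obtain ⟨hn, hj⟩ := hx
    split_ifs at hj <;> dsimp only <;> omega
  have hcard : 2 * P.card = s * (s + 1) + 2 * t := by
    have hsum : ∑ n ∈ Finset.range s, (if n < s then n + 1 else t)
        = ∑ n ∈ Finset.range s, (n + 1) :=
      Finset.sum_congr rfl fun n hn => if_pos (Finset.mem_range.1 hn)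
    have hgauss : (∑ n ∈ Finset.range s, (n + 1)) * 2 = s * (s + 1) := by
      have h := Finset.sum_range_id_mul_two (s + 1)
      rw [Finset.sum_range_succ'] at h
      simpa [mul_comm] using h
    simp only [hP, Finset.card_sigma, Finset.card_range]
    rw [Finset.sum_range_succ, hsum, if_neg (lt_irrefl s)]
    omega
  have hle : (P : Set (Σ _ : ℕ, ℕ)).ncard ≤ B.ncard := by
    refine Set.ncard_le_ncard_of_injOn (fun x => ![x.1 - x.2, x.2]) ?_ ?_ hfin
    · intro x hx
      obtain ⟨h, h' | ⟨h', h''⟩⟩ := hmem x hx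
      · apply hlt
        simp only [Matrix.cons_val_zero, Matrix.cons_val_one]
        omega
      · apply heq <;> simp only [Matrix.cons_val_zero, Matrix.cons_val_one] <;> omega
    · rintro ⟨n, j⟩ hx ⟨n', j'⟩ hx' h
      have h₁ := (hmem _ hx).1
      have h₂ := (hmem _ hx').1
      have e₀ := congrFun h 0
      have e₁ := congrFun h 1
      simp only [Matrix.cons_val_zero, Matrix.cons_val_one] at h₁ h₂ e₀ e₁
      obtain rfl : n = n' := by omega
      rw [e₁]
  rw [Set.ncard_coe_finset] at hle
  omega

/-- A set of lattice points in the square `[0, k)²` has at most `k ^ 2` elements. -/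
theorem ncard_le_sq_of_forall_lt_s16 (k : ℕ) (A : Set (Fin 2 → ℕ)) (hA : ∀ a ∈ A, ∀ i, a i < k) :
    A.ncard ≤ k ^ 2 := by
  have h : A ⊆ (Fintype.piFinset fun _ : Fin 2 => Finset.range k : Finset (Fin 2 → ℕ)) := by
    intro a ha
    simpa using hA a ha
  have hcard := Set.ncard_le_ncard h (Finset.finite_toSet _)
  rw [Set.ncard_coe_finset] at hcard
  simpa using hcard

theorem sq_lt_two_mul_sq_of_lt_two_sub_sqrt_two_mul (q h : ℕ)
    (hq : ((2 * h : ℕ) : ℝ) < (2 - Real.sqrt 2) * q) : h ≤ q ∧ q ^ 2 < 2 * (q - h) ^ 2 := by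
  have hs : Real.sqrt 2 ^ 2 = 2 := Real.sq_sqrt (by norm_num)
  have hs0 : 0 < Real.sqrt 2 := by positivity
  push_cast at hq
  have hle : h ≤ q := by
    have : (h : ℝ) ≤ q := by nlinarith [mul_nonneg hs0.le (Nat.cast_nonneg (α := ℝ) q)]
    exact_mod_cast this
  refine ⟨hle, ?_⟩
  zify [hle]
  have : (q : ℝ) ^ 2 < 2 * ((q : ℝ) - h) ^ 2 := by
    have h₁ : Real.sqrt 2 * q < 2 * ((q : ℝ) - h) := by linarith
    have h₂ : (Real.sqrt 2 * q) ^ 2 < (2 * ((q : ℝ) - h)) ^ 2 :=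
      pow_lt_pow_left₀ h₁ (by positivity) two_ne_zero
    rw [mul_pow, hs] at h₂
    linarith
  exact_mod_cast this

theorem stmt16 (F : Type) [Field F] [Fintype F]
    (d : ℕ) (hd : 1 ≤ d) (heven : Even d)
    (hdq : (d : ℝ) < (2 - Real.sqrt 2) * (Fintype.card F : ℝ))
    (s : ℕ) (hsdef : s = Fintype.card F - d / 2)
    (B₁ : Set (Fin 2 → ℕ))
    (hB₁ : B₁ = {a : Fin 2 → ℕ | a 0 + a 1 < s} ∪
        {a : Fin 2 → ℕ | a 0 + a 1 = s ∧ 2 * a 1 < Fintype.card F - d + 1}) :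
    B₁.ncard >
      ({a : Fin 2 → ℕ | (∀ i, 2 * a i ≤ Fintype.card F - 1) ∧
        d ≤ (Fintype.card F - 2 * a 0) * (Fintype.card F - 2 * a 1)} :
          Set (Fin 2 → ℕ)).ncard := by
  have hqpos : 0 < Fintype.card F := Fintype.card_pos
  generalize Fintype.card F = q at *
  obtain ⟨h, rfl⟩ := even_iff_two_dvd.1 heven
  obtain ⟨hle, hsq⟩ := sq_lt_two_mul_sq_of_lt_two_sub_sqrt_two_mul q h hdq
  obtain rfl : s = q - h := by omega
  obtain ⟨s, rfl⟩ : ∃ s, q = s + h := ⟨q - h, by omega⟩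
  simp only [Nat.add_sub_cancel] at *
  have hsh : h < s := by nlinarith
  have hfin : B₁.Finite := by
    refine (Set.finite_Iic (fun _ : Fin 2 => s)).subset ?_
    rw [hB₁]
    rintro a (ha | ⟨ha, -⟩) i
    · have ha' : a 0 + a 1 < s := ha
      fin_cases i <;> dsimp <;> omega
    · fin_cases i <;> dsimp <;> omega
  have hlow := le_two_mul_ncard_of_triangle_subset s ((s - h) / 2 + 1) (by omega) B₁ hfin
    (fun a ha => by rw [hB₁]; exact Or.inl ha)
    (fun a ha ha' => by rw [hB₁]; exact Or.inr ⟨ha, by omega⟩)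
  refine lt_of_le_of_lt (ncard_le_sq_of_forall_lt_s16 ((s + h + 1) / 2) _ ?_) ?_
  · rintro a ⟨ha, -⟩ i
    have := ha i
    omega
  · obtain ⟨m, hm⟩ := Nat.even_or_odd' (s + h)
    have hk : 2 * ((s + h + 1) / 2) ≤ s + h + 1 := by omega
    rcases hm with hm | hm
    · have e : (s + h + 1) / 2 = m := by omega
      rw [e]
      rw [hm] at hsq
      have ht := Nat.zero_le ((s - h) / 2)
      generalize (s - h) / 2 = t at hlow ht
      clear hdq
      nlinarith
    · have e : (s + h + 1) / 2 = m + 1 := by omega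
      have e' : (s - h) / 2 + 1 + m = s := by omega
      rw [e]
      rw [hm] at hsq
      have hms : 4 * m + 1 < 3 * s := by
        clear hdq hlow
        nlinarith
      generalize (s - h) / 2 = t at hlow e'
      clear hdq
      nlinarith
end
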